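/- arXiv:1805.06732 — 4 statements merged into one kernel-verified Lean document; each statement's English description precedes it below -/
import Mathlib

section
/- Let X and Y be separable metrizable spaces, E ⊂ X × Y an arbitrary subset, and fix an admissible topology on F(E). Then there exists a set Ê ⊂ X × E satisfying: (a) Ẽ ⊂ Ê ⊂ X × E; (b) Ê is closed in X × E and for every x ∈ X the set Ê(x) ∖ Ẽ(x) is countable; (c) the canonical map Φ_Ê : X → F(E), x ↦ Ê(x), is of the first Baire class, and is continuous if X is zero-dimensional. -/
open Set Filter Topology TopologicalSpace

/-- `DimLE X n` : the topological (covering) dimension of `X` is at most `n`, i.e. every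
finite open cover of `X` admits an open shrinking (refinement) of order at most `n + 1`. -/
def DimLE (X : Type*) [TopologicalSpace X] (n : ℕ) : Prop :=
  ∀ (k : ℕ) (U : Fin k → Set X), (∀ i, IsOpen (U i)) → (⋃ i, U i) = Set.univ →
    ∃ V : Fin k → Set X, (∀ i, IsOpen (V i)) ∧ (∀ i, V i ⊆ U i) ∧ (⋃ i, V i) = Set.univ ∧
      ∀ x : X, ({i | x ∈ V i}).ncard ≤ n + 1

/-- The collection `F(X)` of closed subsets of `X`. -/
abbrev Cl (X : Type*) [TopologicalSpace X] : Type _ := {F : Set X // IsClosed F}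

/-- `F₀(X)` : the set of all closed zero-dimensional subsets of `X`. -/
def F0 (X : Type*) [TopologicalSpace X] : Set (Cl X) := {F | DimLE (↥F.1) 0}

/-- The Vietoris topology on subsets of `Y`. -/
def vietoris (Y : Type*) [TopologicalSpace Y] : TopologicalSpace (Set Y) :=
  TopologicalSpace.generateFrom
    ({S | ∃ U : Set Y, IsOpen U ∧ S = {A : Set Y | A ⊆ U}} ∪
     {S | ∃ U : Set Y, IsOpen U ∧ S = {A : Set Y | (A ∩ U).Nonempty}})

/-- A topology `τ` on `F(X)` is admissible if it is induced, via `F ↦ closure (e '' F)`,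
by the Vietoris topology on some metrizable compactification `Y` of `X` (with embedding `e`). -/
def IsAdmissible (X : Type*) [tX : TopologicalSpace X] (τ : TopologicalSpace (Cl X)) : Prop :=
  ∃ (Y : Type) (tY : TopologicalSpace Y) (_ : @CompactSpace Y tY)
    (_ : @TopologicalSpace.MetrizableSpace Y tY) (e : X → Y),
      @Topology.IsEmbedding X Y tX tY e ∧
      τ = (@vietoris Y tY).induced (fun F : Cl X => @closure Y tY (e '' F.1))

/-- An analytic space: a separable metrizable space which is empty or a continuous image
of the Baire space `ℕ → ℕ`. -/
def IsAnalyticSpace (X : Type*) [TopologicalSpace X] : Prop :=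
  TopologicalSpace.MetrizableSpace X ∧ TopologicalSpace.SeparableSpace X ∧
    (IsEmpty X ∨ ∃ f : (ℕ → ℕ) → X, Continuous f ∧ Function.Surjective f)

/-- `Σ¹₂` subsets of a topological space: projections of co-analytic sets. -/
def IsSigma12 {W : Type*} [TopologicalSpace W] (s : Set W) : Prop :=
  ∃ B : Set (W × (ℕ → ℕ)), MeasureTheory.AnalyticSet Bᶜ ∧ s = {w | ∃ y, (w, y) ∈ B}

/-- `Σ¹₂`-hardness (with Cantor space `2^ω = ℕ → Bool` as source). -/
def Sigma12Hard {W : Type*} [TopologicalSpace W] (A : Set W) : Prop :=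
  ∀ A' : Set (ℕ → Bool), IsSigma12 A' →
    ∃ φ : (ℕ → Bool) → W, Continuous φ ∧ A' = φ ⁻¹' A

/-- `Π¹₁`-hardness. -/
def Pi11Hard {W : Type*} [TopologicalSpace W] (A : Set W) : Prop :=
  ∀ A' : Set (ℕ → Bool), MeasureTheory.AnalyticSet A'ᶜ →
    ∃ φ : (ℕ → Bool) → W, Continuous φ ∧ A' = φ ⁻¹' A

/-- The additive Borel classes `Σ⁰ξ` : `Σ⁰₁` consists of the open sets, and for `ξ > 1`,
`Σ⁰ξ` consists of countable unions of sets whose complements are in some `Σ⁰η`, `η < ξ`. -/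
inductive SigmaOrd {W : Type*} [TopologicalSpace W] : Ordinal.{0} → Set W → Prop
  | basic (s : Set W) : IsOpen s → SigmaOrd 1 s
  | union (ξ : Ordinal.{0}) (η : ℕ → Ordinal.{0}) (f : ℕ → Set W) (hξ : 1 < ξ)
      (hη : ∀ n, η n < ξ) (h : ∀ n, SigmaOrd (η n) (f n)ᶜ) : SigmaOrd ξ (⋃ n, f n)

/-- The run produced when player I follows the strategy `σ` and player II plays `β`. -/
def playI (σ : List ℕ → ℕ) (β : ℕ → ℕ) : ℕ → ℕ := fun n =>
  if n % 2 = 0 then σ (List.ofFn fun i : Fin (n / 2) => β i) else β (n / 2)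

/-- Player I has a winning strategy in the game `G_A`. -/
def PlayerIWins (A : Set (ℕ → ℕ)) : Prop :=
  ∃ σ : List ℕ → ℕ, ∀ β : ℕ → ℕ, playI σ β ∈ A

/-- The game operator `Game B` applied to `B ⊆ W × ω^ω`. -/
def GameOp {W : Type*} (B : Set (W × (ℕ → ℕ))) : Set W :=
  {w | PlayerIWins {γ | (w, γ) ∈ B}}

/-- `Game Σ⁰ξ`-hardness. -/
def GameSigmaHard (ξ : Ordinal.{0}) {W : Type*} [TopologicalSpace W] (A : Set W) : Prop :=
  ∀ A' : Set (ℕ → Bool),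
    (∃ B : Set ((ℕ → Bool) × (ℕ → ℕ)), SigmaOrd ξ B ∧ A' = GameOp B) →
    ∃ φ : (ℕ → Bool) → W, Continuous φ ∧ A' = φ ⁻¹' A

/-- A sequence of finite closed covers of `X`, each member of a later cover being contained in a
member of each earlier one, with mesh tending to `0` when measured through `i : X → K`. -/
structure IsShrinkingCover {X K : Type*} [TopologicalSpace X] [Dist K] (i : X → K)
    (R : ℕ → Set (Set X)) : Prop where
  finite : ∀ n, (R n).Finite
  isClosed : ∀ n, ∀ C ∈ R n, IsClosed C
  covers : ∀ n x, ∃ C ∈ R n, x ∈ C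
  refines : ∀ n m, n ≤ m → ∀ C ∈ R m, ∃ C' ∈ R n, C ⊆ C'
  mesh : ∀ n, ∀ C ∈ R (n + 1), ∀ x ∈ C, ∀ y ∈ C, dist (i x) (i y) ≤ (1 / 2) ^ n

/-- For each `n` and `C`, the set `D n C` is a finite `(1 / 2) ^ n`-net in `p ⁻¹' C`, distances
being measured through `e : T → Z`. -/
structure IsFiniteNet {X T Z : Type*} [Dist Z] (p : T → X) (e : T → Z)
    (D : ℕ → Set X → Set T) : Prop where
  finite : ∀ n C, (D n C).Finite
  mem : ∀ n C, ∀ t ∈ D n C, p t ∈ C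
  approx : ∀ n C t, p t ∈ C → ∃ d ∈ D n C, dist (e t) (e d) ≤ (1 / 2) ^ n

/-- The graph of the fibres of `p`, enlarged by all the nets `D n C` with `x ∈ C ∈ R n`. -/
def fiberHull {X T : Type*} (p : T → X) (R : ℕ → Set (Set X)) (D : ℕ → Set X → Set T) :
    Set (X × T) :=
  {q | p q.2 = q.1 ∨ ∃ n, ∃ C ∈ R n, q.1 ∈ C ∧ q.2 ∈ D n C}

theorem exists_isFiniteNet {X T Z : Type*} [MetricSpace Z] [CompactSpace Z] (p : T → X)
    (e : T → Z) : ∃ D, IsFiniteNet p e D := by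
  have h : ∀ (n : ℕ) (C : Set X), ∃ D : Set T, D ⊆ p ⁻¹' C ∧ D.Finite ∧
      e '' (p ⁻¹' C) ⊆ ⋃ y ∈ e '' D, Metric.ball y ((1 / 2) ^ n) := by
    intro n C
    have htb : TotallyBounded (e '' (p ⁻¹' C)) :=
      (isCompact_univ (X := Z)).totallyBounded.subset (subset_univ _)
    exact exists_subset_image_finite_and.1
      (Metric.finite_approx_of_totallyBounded htb ((1 / 2) ^ n) (by positivity))
  choose D hD hfin hcov using h
  refine ⟨D, hfin, fun n C t ht => hD n C ht, fun n C t ht => ?_⟩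
  have := hcov n C (mem_image_of_mem e ht)
  simp only [mem_iUnion, mem_image, Metric.mem_ball, exists_prop] at this
  obtain ⟨_, ⟨d, hd, rfl⟩, hlt⟩ := this
  exact ⟨d, hd, hlt.le⟩

theorem DimLE.exists_isClopen_shrinking {X : Type*} [TopologicalSpace X] (h : DimLE X 0) {k : ℕ}
    (U : Fin k → Set X) (hU : ∀ i, IsOpen (U i)) (hcov : ⋃ i, U i = univ) :
    ∃ V : Fin k → Set X, (∀ i, IsClopen (V i)) ∧ (∀ i, V i ⊆ U i) ∧ ⋃ i, V i = univ := by
  obtain ⟨V, hV, hVU, hVcov, hcard⟩ := h k U hU hcov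
  refine ⟨V, fun i => ⟨?_, hV i⟩, hVU, hVcov⟩
  have hcompl : (V i)ᶜ = ⋃ j ∈ {j | j ≠ i}, V j := by
    ext x
    simp only [mem_compl_iff, mem_iUnion, exists_prop]
    constructor
    · intro hx
      obtain ⟨j, hj⟩ := mem_iUnion.1 (hVcov ▸ mem_univ x : x ∈ ⋃ i, V i)
      exact ⟨j, fun hji => hx (hji ▸ hj), hj⟩
    · rintro ⟨j, hji, hj⟩ hi
      exact hji ((ncard_le_one (toFinite _)).1 (hcard x) j hj i hi)
  rw [← isOpen_compl_iff, hcompl]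
  exact isOpen_biUnion fun j _ => hV j

theorem exists_finite_closed_cover {X K : Type*} [TopologicalSpace X] [MetricSpace K]
    [CompactSpace K] {i : X → K} (hi : Continuous i) {ε : ℝ} (hε : 0 < ε) :
    ∃ A : Set (Set X), A.Finite ∧ (∀ C ∈ A, IsClosed C) ∧ (∀ x, ∃ C ∈ A, x ∈ C) ∧
      (∀ C ∈ A, ∀ x ∈ C, ∀ y ∈ C, dist (i x) (i y) ≤ ε) ∧ (DimLE X 0 → ∀ C ∈ A, IsOpen C) := by
  obtain ⟨t, -, htf, htc⟩ :=
    (isCompact_univ (X := K)).finite_cover_balls (half_pos hε)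
  have hdist : ∀ (c : K) (C : Set X), C ⊆ i ⁻¹' Metric.closedBall c (ε / 2) →
      ∀ x ∈ C, ∀ y ∈ C, dist (i x) (i y) ≤ ε := by
    intro c C hC x hx y hy
    have h₁ := Metric.mem_closedBall.1 (hC hx)
    have h₂ := Metric.mem_closedBall'.1 (hC hy)
    linarith [dist_triangle (i x) c (i y)]
  have hmem : ∀ x, ∃ c ∈ t, i x ∈ Metric.ball c (ε / 2) := fun x => by
    simpa using htc (mem_univ (i x))
  by_cases hdim : DimLE X 0
  · have := htf.to_subtype
    let φ := Finite.equivFin t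
    obtain ⟨V, hV, hVU, hVcov⟩ := hdim.exists_isClopen_shrinking
      (fun j => i ⁻¹' Metric.ball (φ.symm j : K) (ε / 2))
      (fun j => Metric.isOpen_ball.preimage hi) (eq_univ_of_forall fun x => by
        obtain ⟨c, hc, hx⟩ := hmem x
        exact mem_iUnion.2 ⟨φ ⟨c, hc⟩, by rwa [mem_preimage, φ.symm_apply_apply]⟩)
    refine ⟨range V, finite_range V, ?_, ?_, ?_, ?_⟩
    · rintro _ ⟨j, rfl⟩
      exact (hV j).isClosed
    · intro x
      obtain ⟨j, hj⟩ := mem_iUnion.1 (hVcov ▸ mem_univ x : x ∈ ⋃ i, V i)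
      exact ⟨_, mem_range_self j, hj⟩
    · rintro _ ⟨j, rfl⟩
      exact hdist (φ.symm j) _ ((hVU j).trans (preimage_mono Metric.ball_subset_closedBall))
    · rintro - _ ⟨j, rfl⟩
      exact (hV j).isOpen
  · refine ⟨(fun c => i ⁻¹' Metric.closedBall c (ε / 2)) '' t, htf.image _, ?_, ?_, ?_,
      fun h => absurd h hdim⟩
    · rintro _ ⟨c, -, rfl⟩
      exact Metric.isClosed_closedBall.preimage hi
    · intro x
      obtain ⟨c, hc, hx⟩ := hmem x
      exact ⟨_, mem_image_of_mem _ hc, Metric.ball_subset_closedBall hx⟩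
    · rintro _ ⟨c, -, rfl⟩
      exact hdist c _ Subset.rfl

theorem exists_isShrinkingCover {X K : Type*} [TopologicalSpace X] [MetricSpace K]
    [CompactSpace K] {i : X → K} (hi : Continuous i) :
    ∃ R, IsShrinkingCover i R ∧ (DimLE X 0 → ∀ n, ∀ C ∈ R n, IsOpen C) := by
  choose A hfin hcl hcov hmesh hop using fun n : ℕ =>
    exists_finite_closed_cover hi (ε := (1 / 2) ^ n) (by positivity)
  let R : ℕ → Set (Set X) := fun n => n.rec {univ} fun n S => image2 (· ∩ ·) S (A n)
  have hR : ∀ n, R (n + 1) = image2 (· ∩ ·) (R n) (A n) := fun _ => rfl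
  refine ⟨R, ⟨?_, ?_, ?_, ?_, ?_⟩, ?_⟩
  · intro n
    induction n with
    | zero => exact finite_singleton _
    | succ n ih => exact ih.image2 _ (hfin n)
  · intro n
    induction n with
    | zero =>
      rintro C rfl
      exact isClosed_univ
    | succ n ih =>
      rintro _ ⟨B, hB, C, hC, rfl⟩
      exact (ih B hB).inter (hcl n C hC)
  · intro n x
    induction n with
    | zero => exact ⟨univ, rfl, mem_univ x⟩
    | succ n ih =>
      obtain ⟨B, hB, hxB⟩ := ih
      obtain ⟨C, hC, hxC⟩ := hcov n x
      exact ⟨_, mem_image2_of_mem hB hC, hxB, hxC⟩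
  · intro n m hnm
    induction m, hnm using Nat.le_induction with
    | base => exact fun C hC => ⟨C, hC, Subset.rfl⟩
    | succ m _ ih =>
      rintro _ ⟨B, hB, C, hC, rfl⟩
      obtain ⟨C', hC', hsub⟩ := ih B hB
      exact ⟨C', hC', inter_subset_left.trans hsub⟩
  · rintro n _ ⟨B, hB, C, hC, rfl⟩ x hx y hy
    exact hmesh n C hC x hx.2 y hy.2
  · intro hdim n
    induction n with
    | zero =>
      rintro C rfl
      exact isOpen_univ
    | succ n ih =>
      rintro _ ⟨B, hB, C, hC, rfl⟩
      exact (ih B hB).inter (hop n hdim C hC)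

section FiberHull

variable {X T K Z : Type*} [TopologicalSpace X] [MetricSpace K] [MetricSpace Z]
  {p : T → X} {i : X → K} {e : T → Z} {R : ℕ → Set (Set X)} {D : ℕ → Set X → Set T}

theorem isClosed_fiberHull [TopologicalSpace T] [T1Space T] (hp : Continuous p) (hi : Continuous i)
    (hinj : Function.Injective i) (hR : IsShrinkingCover i R) (hD : IsFiniteNet p e D) :
    IsClosed (fiberHull p R D) := by
  have heq : fiberHull p R D = ⋂ N : ℕ,
      ((⋃ n ∈ Iic N, ⋃ C ∈ R n, C ×ˢ D n C) ∪
        {q : X × T | dist (i q.1) (i (p q.2)) ≤ (1 / 2) ^ N}) := by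
    ext ⟨x, t⟩
    simp only [mem_iInter, mem_union, mem_iUnion, exists_prop, mem_prod, mem_Iic]
    constructor
    · rintro (h | ⟨n, C, hC, hx, ht⟩) N
      · right
        change p t = x at h
        simp [h]
      · rcases le_or_gt n N with hn | hn
        · exact Or.inl ⟨n, hn, C, hC, hx, ht⟩
        · right
          obtain ⟨C', hC', hsub⟩ := hR.refines (N + 1) n hn C hC
          exact hR.mesh N C' hC' x (hsub hx) _ (hsub (hD.mem n C t ht))
    · intro h
      by_cases hE : ∃ n, ∃ C ∈ R n, x ∈ C ∧ t ∈ D n C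
      · exact Or.inr hE
      · left
        have hle : ∀ N : ℕ, dist (i x) (i (p t)) ≤ (1 / 2) ^ N := fun N =>
          (h N).resolve_left fun ⟨n, _, hn⟩ => hE ⟨n, hn⟩
        have hlim : Tendsto (fun N : ℕ => (1 / 2 : ℝ) ^ N) atTop (𝓝 0) :=
          tendsto_pow_atTop_nhds_zero_of_lt_one (by norm_num) (by norm_num)
        exact (hinj (dist_le_zero.1 (ge_of_tendsto' hlim hle))).symm
  rw [heq]
  refine isClosed_iInter fun N => IsClosed.union ?_ ?_
  · exact (finite_Iic N).isClosed_biUnion fun n _ => (hR.finite n).isClosed_biUnion fun C hC =>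
      (hR.isClosed n C hC).prod (hD.finite n C).isClosed
  · exact isClosed_le (by fun_prop) continuous_const

theorem countable_fiberHull_diff (hR : IsShrinkingCover i R) (hD : IsFiniteNet p e D) (x : X) :
    ({t | (x, t) ∈ fiberHull p R D} \ {t | p t = x}).Countable := by
  have hc : (⋃ n, ⋃ C ∈ R n, D n C).Countable := countable_iUnion fun n =>
    (hR.finite n).countable.biUnion fun C _ => (hD.finite n C).countable
  refine hc.mono ?_
  rintro t ⟨h | ⟨n, C, hC, -, ht⟩, hne⟩
  · exact absurd h hne
  · exact mem_iUnion.2 ⟨n, mem_biUnion hC ht⟩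

theorem isOpen_setOf_closure_fiberHull_subset [CompactSpace Z] (hR : IsShrinkingCover i R)
    (hD : IsFiniteNet p e D) {W : Set Z} (hW : IsOpen W) :
    IsOpen {x | closure (e '' {t | (x, t) ∈ fiberHull p R D}) ⊆ W} := by
  rw [isOpen_iff_mem_nhds]
  intro x hx
  obtain ⟨δ, hδ, hsub⟩ := isClosed_closure.isCompact.exists_cthickening_subset_open hW hx
  obtain ⟨N, hN⟩ := exists_pow_lt_of_lt_one hδ (by norm_num : (1 / 2 : ℝ) < 1)
  have hG : ∀ᶠ x' in 𝓝 x, ∀ n ∈ Iic N, ∀ C ∈ R n, x' ∈ C → x ∈ C := by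
    refine (eventually_all_finite (finite_Iic N)).2 fun n _ =>
      (eventually_all_finite (hR.finite n)).2 fun C hC => ?_
    by_cases hxC : x ∈ C
    · exact Eventually.of_forall fun _ _ => hxC
    · filter_upwards [(hR.isClosed n C hC).isOpen_compl.mem_nhds hxC] with x' h h'
      exact absurd h' h
  filter_upwards [hG] with x' hx'
  refine (closure_minimal ?_ Metric.isClosed_cthickening).trans hsub
  have hnear : ∀ C ∈ R N, x' ∈ C → ∀ t, p t ∈ C →
      e t ∈ Metric.cthickening δ (closure (e '' {t | (x, t) ∈ fiberHull p R D})) := by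
    intro C hC hxC t ht
    obtain ⟨d, hd, hdist⟩ := hD.approx N C t ht
    refine Metric.mem_cthickening_of_dist_le (e t) (e d) δ _ (subset_closure ?_)
      (hdist.trans hN.le)
    exact mem_image_of_mem e (Or.inr ⟨N, C, hC, hx' N self_mem_Iic C hC hxC, hd⟩)
  rintro _ ⟨t, h | ⟨n, C, hC, hxC, ht⟩, rfl⟩
  · obtain ⟨C, hC, hxC⟩ := hR.covers N x'
    change p t = x' at h
    exact hnear C hC hxC t (h ▸ hxC)
  · rcases le_or_gt n N with hn | hn
    · refine Metric.self_subset_cthickening _ (subset_closure ?_)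
      exact mem_image_of_mem e (Or.inr ⟨n, C, hC, hx' n hn C hC hxC, ht⟩)
    · obtain ⟨C', hC', hCC'⟩ := hR.refines N n hn.le C hC
      exact hnear C' hC' (hCC' hxC) t (hCC' (hD.mem n C t ht))

theorem setOf_closure_fiberHull_inter_nonempty (hR : IsShrinkingCover i R)
    (hD : IsFiniteNet p e D) {V : Set Z} (hV : IsOpen V) :
    {x | (closure (e '' {t | (x, t) ∈ fiberHull p R D}) ∩ V).Nonempty} =
      ⋃ n, ⋃ C ∈ {C ∈ R n | ∃ d ∈ D n C, e d ∈ V}, C := by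
  ext x
  simp only [mem_ofPred_eq, mem_iUnion, exists_prop]
  rw [closure_inter_open_nonempty_iff hV]
  constructor
  · rintro ⟨_, ⟨t, h | ⟨n, C, hC, hxC, ht⟩, rfl⟩, hz⟩
    · change p t = x at h
      subst h
      obtain ⟨ε, hε, hball⟩ := Metric.isOpen_iff.1 hV _ hz
      obtain ⟨n, hn⟩ := exists_pow_lt_of_lt_one hε (by norm_num : (1 / 2 : ℝ) < 1)
      obtain ⟨C, hC, hxC⟩ := hR.covers n (p t)
      obtain ⟨d, hd, hdist⟩ := hD.approx n C t hxC
      exact ⟨n, C, ⟨hC, d, hd, hball (Metric.mem_ball'.2 (hdist.trans_lt hn))⟩, hxC⟩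
    · exact ⟨n, C, ⟨hC, t, ht, hz⟩, hxC⟩
  · rintro ⟨n, C, ⟨hC, d, hd, hdV⟩, hxC⟩
    exact ⟨e d, mem_image_of_mem e (Or.inr ⟨n, C, hC, hxC, hd⟩), hdV⟩

theorem isGδ_compl_setOf_closure_fiberHull_inter_nonempty (hR : IsShrinkingCover i R)
    (hD : IsFiniteNet p e D) {V : Set Z} (hV : IsOpen V) :
    IsGδ {x | (closure (e '' {t | (x, t) ∈ fiberHull p R D}) ∩ V).Nonempty}ᶜ := by
  rw [setOf_closure_fiberHull_inter_nonempty hR hD hV, compl_iUnion]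
  refine IsGδ.iInter_of_isOpen fun n => isOpen_compl_iff.2 ?_
  exact ((hR.finite n).subset (sep_subset _ _)).isClosed_biUnion fun C hC =>
    hR.isClosed n C hC.1

theorem isOpen_setOf_closure_fiberHull_inter_nonempty (hR : IsShrinkingCover i R)
    (hD : IsFiniteNet p e D) (hopen : ∀ n, ∀ C ∈ R n, IsOpen C) {V : Set Z} (hV : IsOpen V) :
    IsOpen {x | (closure (e '' {t | (x, t) ∈ fiberHull p R D}) ∩ V).Nonempty} := by
  rw [setOf_closure_fiberHull_inter_nonempty hR hD hV]
  exact isOpen_iUnion fun n => isOpen_biUnion fun C hC => hopen n C hC.1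

end FiberHull

theorem isGδ_compl_of_isOpen_generateFrom {X : Type*} [TopologicalSpace X] {S : Set (Set X)}
    (hS : S.Countable) (hG : ∀ s ∈ S, IsGδ sᶜ) {U : Set X} (hU : IsOpen[generateFrom S] U) :
    IsGδ Uᶜ := by
  have hB := @isTopologicalBasis_of_subbasis X (generateFrom S) S rfl
  obtain ⟨Q, hQ, rfl⟩ := @IsTopologicalBasis.open_eq_sUnion X (generateFrom S) _ hB _ hU
  rw [compl_sUnion]
  refine IsGδ.sInter ?_ (((countable_ofPred_finite_subset hS).image _).mono hQ |>.image _)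
  rintro _ ⟨q, hq, rfl⟩
  obtain ⟨f, ⟨hf, hfS⟩, rfl⟩ := hQ hq
  change IsGδ (⋂₀ f)ᶜ
  rw [compl_sInter]
  refine IsGδ.sUnion (hf.image _) ?_
  rintro _ ⟨s, hs, rfl⟩
  exact hG s (hfS hs)

theorem continuous_vietoris {X Z : Type*} [TopologicalSpace X] [TopologicalSpace Z]
    {ψ : X → Set Z} (hup : ∀ W, IsOpen W → IsOpen {x | ψ x ⊆ W})
    (hlow : ∀ V, IsOpen V → IsOpen {x | (ψ x ∩ V).Nonempty}) :
    @Continuous _ _ _ (vietoris Z) ψ := by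
  refine continuous_generateFrom_iff.2 ?_
  rintro _ (⟨U, hU, rfl⟩ | ⟨U, hU, rfl⟩)
  · exact hup U hU
  · exact hlow U hU

theorem isGδ_compl_preimage_vietoris {X Z : Type*} [TopologicalSpace X] [PerfectlyNormalSpace X]
    [SecondCountableTopology X] [TopologicalSpace Z] [SecondCountableTopology Z]
    {ψ : X → Set Z} (hup : ∀ W, IsOpen W → IsOpen {x | ψ x ⊆ W})
    (hlow : ∀ V, IsOpen V → IsGδ {x | (ψ x ∩ V).Nonempty}ᶜ) {O : Set (Set Z)}
    (hO : IsOpen[vietoris Z] O) : IsGδ (ψ ⁻¹' O)ᶜ := by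
  let S : Set (Set X) := countableBasis X ∪
    (fun V : Set Z => {x | (ψ x ∩ V).Nonempty}) '' countableBasis Z
  have hle : generateFrom S ≤ ‹TopologicalSpace X› := by
    rw [(isBasis_countableBasis X).eq_generateFrom]
    exact generateFrom_anti subset_union_left
  refine isGδ_compl_of_isOpen_generateFrom (S := S)
    ((countable_countableBasis X).union ((countable_countableBasis Z).image _)) ?_ ?_
  · rintro _ (hs | ⟨V, hV, rfl⟩)
    · exact (isOpen_of_mem_countableBasis hs).isClosed_compl.isGδ
    · exact hlow V (isOpen_of_mem_countableBasis hV)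
  · suffices h : @Continuous _ _ (generateFrom S) (vietoris Z) ψ from continuous_def.1 h O hO
    refine @continuous_vietoris X Z (generateFrom S) _ ψ (fun W hW => hle _ (hup W hW))
      fun V hV => ?_
    have heq : {x | (ψ x ∩ V).Nonempty} =
        ⋃ B ∈ {B ∈ countableBasis Z | B ⊆ V}, {x | (ψ x ∩ B).Nonempty} := by
      ext x
      simp only [mem_ofPred_eq, mem_iUnion, exists_prop]
      constructor
      · rintro ⟨z, hz, hzV⟩
        obtain ⟨B, hB, hzB, hBV⟩ :=
          (isBasis_countableBasis Z).exists_subset_of_mem_open hzV hV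
        exact ⟨B, ⟨hB, hBV⟩, z, hz, hzB⟩
      · rintro ⟨B, ⟨-, hBV⟩, z, hz, hzB⟩
        exact ⟨z, hz, hBV hzB⟩
    rw [heq]
    exact @isOpen_biUnion X _ (generateFrom S) _ _ fun B hB =>
      isOpen_generateFrom_of_mem (Or.inr (mem_image_of_mem _ hB.1))

/-- Let `X`, `Y` be separable metrizable spaces, `E ⊆ X × Y`, and fix an admissible
topology `τ` on `F(E)`. Then there exists `Ê ⊆ X × E` with: (a) `Ẽ ⊆ Ê`;
(b) `Ê` is closed in `X × E` and each section `Ê(x) ∖ Ẽ(x)` is countable;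
(c) the canonical map `Φ_Ê : X → F(E)`, `x ↦ Ê(x)`, is of the first Baire class
(preimages of `τ`-open sets are `F_σ`), and is continuous if `X` is zero-dimensional. -/
theorem exists_hatE {X Y : Type*} [TopologicalSpace X] [TopologicalSpace.MetrizableSpace X]
    [TopologicalSpace.SeparableSpace X] [TopologicalSpace Y]
    [TopologicalSpace.MetrizableSpace Y] [TopologicalSpace.SeparableSpace Y]
    (E : Set (X × Y)) (τ : TopologicalSpace (Cl ↥E)) (hτ : IsAdmissible (↥E) τ) :
    ∃ Ehat : Set (X × ↥E),
      {p : X × ↥E | ((p.2 : X × Y)).1 = p.1} ⊆ Ehat ∧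
      IsClosed Ehat ∧
      (∀ x : X,
        Set.Countable ({e : ↥E | (x, e) ∈ Ehat} \ {e : ↥E | ((e : X × Y)).1 = x})) ∧
      ∃ Φ : X → Cl ↥E,
        (∀ x : X, (Φ x).1 = {e : ↥E | (x, e) ∈ Ehat}) ∧
        (∀ U : Set (Cl ↥E), @IsOpen _ τ U →
          ∃ F : ℕ → Set X, (∀ n, IsClosed (F n)) ∧ Φ ⁻¹' U = ⋃ n, F n) ∧
        (DimLE X 0 → @Continuous _ _ _ τ Φ) := by
  obtain ⟨Z, tZ, _, _, e, he, rfl⟩ := hτ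
  let := metrizableSpaceMetric Z
  let := metrizableSpaceMetric X
  have : SecondCountableTopology X := UniformSpace.secondCountable_of_separable X
  obtain ⟨i, hi⟩ := Metric.PiNatEmbed.exists_embedding_to_hilbert_cube (X := X)
  let := metrizableSpaceMetric (ℕ → unitInterval)
  let p : E → X := fun t => (t : X × Y).1
  have hp : Continuous p := continuous_fst.comp continuous_subtype_val
  obtain ⟨R, hR, hRopen⟩ := exists_isShrinkingCover hi.continuous
  obtain ⟨D, hD⟩ := exists_isFiniteNet p e
  have hclosed := isClosed_fiberHull hp hi.continuous hi.injective hR hD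
  have hup := fun W (hW : IsOpen W) => isOpen_setOf_closure_fiberHull_subset hR hD hW
  refine ⟨fiberHull p R D, fun q hq => Or.inl hq, hclosed, countable_fiberHull_diff hR hD,
    fun x => ⟨{t | (x, t) ∈ fiberHull p R D}, hclosed.preimage (Continuous.prodMk_right x)⟩,
    fun x => rfl, ?_, fun hdim => ?_⟩
  · rintro U ⟨O, hO, rfl⟩
    obtain ⟨f, hf, heq⟩ := isGδ_iff_eq_iInter_nat.1 (isGδ_compl_preimage_vietoris hup
      (fun V hV => isGδ_compl_setOf_closure_fiberHull_inter_nonempty hR hD hV) hO)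
    refine ⟨fun n => (f n)ᶜ, fun n => (hf n).isClosed_compl, ?_⟩
    rw [← compl_iInter, ← heq, compl_compl]
    rfl
  · exact continuous_induced_rng.2 (continuous_vietoris hup fun V hV =>
      isOpen_setOf_closure_fiberHull_inter_nonempty hR hD (hRopen hdim) hV)
end

section
/- Let X be a zero-dimensional Polish space, Y a separable metrizable space, and E ⊂ X × Y. Then the set E₀ = {x ∈ X : dim E(x) = 0} is reducible to F₀(E): there exists a continuous map φ : X → F(E) (for any admissible topology on F(E)) with E₀ = φ⁻¹(F₀(E)). -/
open Set Filter Topology TopologicalSpace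

/-- In dimension zero every finite open cover has a pairwise disjoint open shrinking. -/
theorem dimLE_zero_iff {Z : Type*} [TopologicalSpace Z] :
    DimLE Z 0 ↔ ∀ (k : ℕ) (U : Fin k → Set Z), (∀ i, IsOpen (U i)) → (⋃ i, U i) = Set.univ →
      ∃ V : Fin k → Set Z, (∀ i, IsOpen (V i)) ∧ (∀ i, V i ⊆ U i) ∧ (⋃ i, V i) = Set.univ ∧
        ∀ i j z, z ∈ V i → z ∈ V j → i = j := by
  have key : ∀ (k : ℕ) (V : Fin k → Set Z),
      (∀ x : Z, ({i | x ∈ V i}).ncard ≤ 0 + 1) ↔ ∀ i j z, z ∈ V i → z ∈ V j → i = j := by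
    intro k V
    simp only [zero_add, Set.ncard_le_one (Set.toFinite _)]
    exact ⟨fun h i j z hi hj => h z i hi j hj, fun h z i hi j hj => h i j z hi hj⟩
  unfold DimLE
  simp only [key]

/-- Zero-dimensionality passes to closed subspaces. -/
theorem DimLE.of_isClosedEmbedding {A Z : Type*} [TopologicalSpace A] [TopologicalSpace Z]
    {g : A → Z} (hg : IsClosedEmbedding g) (hZ : DimLE Z 0) : DimLE A 0 := by
  rw [dimLE_zero_iff] at hZ ⊢
  intro k U hU hcov
  choose U' hU'o hU' using fun i => hg.isInducing.isOpen_iff.1 (hU i)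
  rcases isEmpty_or_nonempty A with hA | ⟨⟨a₀⟩⟩
  · exact ⟨U, hU, fun i => Subset.rfl, hcov, fun i j z => hA.elim z⟩
  obtain ⟨i₀, -⟩ := mem_iUnion.1 (hcov.symm ▸ mem_univ a₀ : a₀ ∈ ⋃ i, U i)
  obtain ⟨V, hVo, hVU, hVcov, hVd⟩ := hZ k (fun i => U' i ∪ (range g)ᶜ)
    (fun i => (hU'o i).union hg.isClosed_range.isOpen_compl) (by
      refine eq_univ_of_forall fun z => ?_
      by_cases hz : z ∈ range g
      · obtain ⟨a, rfl⟩ := hz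
        obtain ⟨i, hi⟩ := mem_iUnion.1 (hcov.symm ▸ mem_univ a : a ∈ ⋃ i, U i)
        rw [← hU' i] at hi
        exact mem_iUnion.2 ⟨i, Or.inl hi⟩
      · exact mem_iUnion.2 ⟨i₀, Or.inr hz⟩)
  refine ⟨fun i => g ⁻¹' V i, fun i => (hVo i).preimage hg.continuous, fun i a ha => ?_, ?_,
    fun i j a hi hj => hVd i j (g a) hi hj⟩
  · rcases hVU i ha with h | h
    · rw [← hU' i]
      exact h
    · exact absurd (mem_range_self a) h
  · rw [← preimage_iUnion, hVcov, preimage_univ]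

/-- Adding isolated points to a closed zero-dimensional subspace of a normal space yields a
zero-dimensional space. -/
theorem DimLE.of_isClosedEmbedding_of_isolated {A Z : Type*} [TopologicalSpace A]
    [TopologicalSpace Z] [NormalSpace Z] {g : A → Z} (hg : IsClosedEmbedding g)
    (hA : DimLE A 0) (hiso : ∀ z ∉ range g, IsOpen ({z} : Set Z)) : DimLE Z 0 := by
  rw [dimLE_zero_iff] at hA ⊢
  intro k U hU hcov
  obtain ⟨V, hVo, hVU, hVcov, hVd⟩ := hA k (fun i => g ⁻¹' U i)
    (fun i => (hU i).preimage hg.continuous) (by rw [← preimage_iUnion, hcov, preimage_univ])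
  have hVclosed : ∀ i, IsClosed (V i) := by
    intro i
    have : V i = (⋃ j ∈ {j | j ≠ i}, V j)ᶜ := by
      ext a
      simp only [mem_compl_iff, mem_iUnion, mem_ofPred_eq, not_exists]
      refine ⟨fun h j hj hj' => hj (hVd j i a hj' h), fun h => ?_⟩
      obtain ⟨j, hj⟩ := mem_iUnion.1 (hVcov.symm ▸ mem_univ a : a ∈ ⋃ i, V i)
      by_cases hji : j = i
      · exact hji ▸ hj
      · exact absurd hj (h j hji)
    rw [this]
    exact (isOpen_biUnion fun j _ => hVo j).isClosed_compl
  have hdisj : Pairwise (Function.onFun Disjoint fun i => 𝓝ˢ (g '' V i)) := by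
    intro i j hij
    refine disjoint_nhdsSet_nhdsSet (hg.isClosedMap _ (hVclosed i))
      (hg.isClosedMap _ (hVclosed j)) ?_
    rw [disjoint_image_iff hg.injective, disjoint_left]
    exact fun a hi hj => hij (hVd i j a hi hj)
  obtain ⟨s, hs, hsd⟩ := hdisj.exists_mem_filter_of_disjoint
  let W : Fin k → Set Z := fun i => interior (s i) ∩ U i
  have hWo : ∀ i, IsOpen (W i) := fun i => isOpen_interior.inter (hU i)
  have hWd : ∀ i j z, z ∈ W i → z ∈ W j → i = j := by
    intro i j z hi hj
    by_contra hij
    exact disjoint_left.1 (hsd hij) (interior_subset hi.1) (interior_subset hj.1)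
  have hrange : ∀ a, g a ∈ ⋃ i, W i := by
    intro a
    obtain ⟨i, hi⟩ := mem_iUnion.1 (hVcov.symm ▸ mem_univ a : a ∈ ⋃ i, V i)
    exact mem_iUnion.2 ⟨i, subset_interior_iff_mem_nhdsSet.2 (hs i) (mem_image_of_mem g hi),
      hVU i hi⟩
  choose c hc using fun z => mem_iUnion.1 (hcov.symm ▸ mem_univ z : z ∈ ⋃ i, U i)
  refine ⟨fun i => W i ∪ {z | z ∉ (⋃ j, W j) ∧ c z = i}, fun i => (hWo i).union ?_, ?_, ?_, ?_⟩
  · rw [← biUnion_of_singleton {z | z ∉ (⋃ j, W j) ∧ c z = i}]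
    refine isOpen_biUnion fun z hz => hiso z ?_
    rintro ⟨a, rfl⟩
    exact hz.1 (hrange a)
  · rintro i z (hz | ⟨-, rfl⟩)
    · exact hz.2
    · exact hc z
  · refine eq_univ_of_forall fun z => ?_
    by_cases hz : z ∈ ⋃ j, W j
    · obtain ⟨i, hi⟩ := mem_iUnion.1 hz
      exact mem_iUnion.2 ⟨i, Or.inl hi⟩
    · exact mem_iUnion.2 ⟨c z, Or.inr ⟨hz, rfl⟩⟩
  · rintro i j z (hi | ⟨hi, hi'⟩) (hj | ⟨hj, hj'⟩)
    · exact hWd i j z hi hj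
    · exact absurd (mem_iUnion.2 ⟨i, hi⟩) hj
    · exact absurd (mem_iUnion.2 ⟨j, hj⟩) hi
    · exact hi'.symm.trans hj'

/-- In a zero-dimensional `T₁` space the clopen sets form a basis. -/
theorem DimLE.isTopologicalBasis_isClopen {X : Type*} [TopologicalSpace X] [T1Space X]
    (hX : DimLE X 0) : IsTopologicalBasis {s : Set X | IsClopen s} := by
  rw [dimLE_zero_iff] at hX
  refine isTopologicalBasis_of_isOpen_of_nhds (fun s hs => hs.isOpen) fun x O hx hO => ?_
  obtain ⟨V, hVo, hVU, hVcov, hVd⟩ := hX 2 ![O, {x}ᶜ]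
    (by simp [Fin.forall_fin_two, hO])
    (by
      refine eq_univ_of_forall fun z => ?_
      by_cases hz : z = x
      · exact mem_iUnion.2 ⟨0, by simpa [hz] using hx⟩
      · exact mem_iUnion.2 ⟨1, by simpa using hz⟩)
  have hcov : ∀ z, z ∈ V 0 ∨ z ∈ V 1 := fun z => by
    obtain ⟨i, hi⟩ := mem_iUnion.1 (hVcov.symm ▸ mem_univ z : z ∈ ⋃ i, V i)
    fin_cases i
    · exact Or.inl hi
    · exact Or.inr hi
  have h01 : V 0 = (V 1)ᶜ := by
    ext z
    exact ⟨fun h h' => absurd (hVd 0 1 z h h') (by decide), fun h => (hcov z).resolve_right h⟩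
  refine ⟨V 0, ⟨?_, hVo 0⟩, (hcov x).resolve_right fun h => ?_, hVU 0⟩
  · rw [h01]
    exact (hVo 1).isClosed_compl
  · simpa using hVU 1 h

/-- A second countable zero-dimensional `T₁` space has a sequence of clopen sets separating
its points. -/
theorem DimLE.exists_seq_isClopen_separating {X : Type*} [TopologicalSpace X] [T1Space X]
    [SecondCountableTopology X] (hX : DimLE X 0) :
    ∃ B : ℕ → Set X, (∀ n, IsClopen (B n)) ∧ ∀ x a, a ≠ x → ∃ n, x ∈ B n ∧ a ∉ B n := by
  obtain ⟨b, hb, hbc, hbasis⟩ := hX.isTopologicalBasis_isClopen.exists_countable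
  obtain ⟨B, hB⟩ := (hbc.insert univ).exists_eq_range (insert_nonempty _ _)
  refine ⟨B, fun n => ?_, fun x a hax => ?_⟩
  · have : B n ∈ insert univ b := hB ▸ mem_range_self n
    rcases this with h | h
    · exact h ▸ isClopen_univ
    · exact hb h
  · obtain ⟨s, hs, hxs, hsa⟩ := hbasis.exists_subset_of_mem_open
      (show x ∈ ({a}ᶜ : Set X) from fun h => hax h.symm) isOpen_compl_singleton
    obtain ⟨n, rfl⟩ : s ∈ range B := hB ▸ mem_insert_of_mem _ hs
    exact ⟨n, hxs, fun h => hsa h rfl⟩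

/-- The clopen cells of the decreasing sequence of partitions generated by a sequence of clopen
separating sets. -/
theorem DimLE.exists_partition_cells {X : Type*} [TopologicalSpace X] [T1Space X]
    [SecondCountableTopology X] (hX : DimLE X 0) :
    ∃ U : ℕ → X → Set X, (∀ n x, IsClopen (U n x)) ∧ (∀ n x, x ∈ U n x) ∧
      (∀ n x, ∀ a ∈ U n x, ∀ m ≤ n, U m a = U m x) ∧ ∀ x a, a ≠ x → ∃ n, a ∉ U n x := by
  obtain ⟨B, hB, hsep⟩ := hX.exists_seq_isClopen_separating
  refine ⟨fun n x => {a | ∀ i < n, (a ∈ B i ↔ x ∈ B i)}, fun n x => ?_, fun n x i _ => Iff.rfl,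
    fun n x a ha m hm => ?_, fun x a hax => ?_⟩
  · have : {a | ∀ i < n, (a ∈ B i ↔ x ∈ B i)} = ⋂ i ∈ Iio n, {a | a ∈ B i ↔ x ∈ B i} := by
      ext a
      simp
    beta_reduce
    rw [this]
    refine (finite_Iio n).isClopen_biInter fun i _ => ?_
    by_cases hx : x ∈ B i
    · simpa [hx] using hB i
    · simp only [hx, iff_false]
      exact (hB i).compl
  · ext z
    exact forall₂_congr fun i hi => by rw [ha i (hi.trans_le hm)]
  · obtain ⟨n, hx, ha⟩ := hsep x a hax
    exact ⟨n + 1, fun h => ha ((h n n.lt_succ_self).2 hx)⟩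

/-- A map into closed sets is continuous for the topology induced by a compact metric space if
locally its values have a common part which is `1 / (n + 1)`-dense. -/
theorem continuous_vietoris_of_common_net {X K : Type*} [TopologicalSpace X] [MetricSpace K]
    [CompactSpace K] (P : X → Set K) (C : ℕ → X → Set K) (U : ℕ → X → Set X)
    (hU : ∀ n x, U n x ∈ 𝓝 x) (hCP : ∀ n x, ∀ a ∈ U n x, C n x ⊆ P a)
    (hPC : ∀ n x, ∀ a ∈ U n x, ∀ p ∈ P a, ∃ q ∈ C n x, dist p q < 1 / ((n : ℝ) + 1)) :
    @Continuous _ _ _ (vietoris K) fun x => closure (P x) := by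
  refine continuous_generateFrom_iff.2 ?_
  rintro S (⟨O, hO, rfl⟩ | ⟨O, hO, rfl⟩) <;> rw [isOpen_iff_mem_nhds] <;> intro x hx
  · obtain ⟨δ, hδ, hδO⟩ := isClosed_closure.isCompact.exists_cthickening_subset_open hO hx
    obtain ⟨n, hn⟩ := exists_nat_one_div_lt hδ
    filter_upwards [hU n x] with a ha
    refine (closure_minimal (fun p hp => ?_) Metric.isClosed_cthickening).trans hδO
    obtain ⟨q, hq, hpq⟩ := hPC n x a ha p hp
    exact Metric.mem_cthickening_of_dist_le p q δ _
      (subset_closure (hCP n x x (mem_of_mem_nhds (hU n x)) hq)) (hpq.trans hn).le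
  · obtain ⟨p, hpP, hpO⟩ := (closure_inter_open_nonempty_iff hO).1 hx
    obtain ⟨ε, hε, hεO⟩ := Metric.isOpen_iff.1 hO p hpO
    obtain ⟨n, hn⟩ := exists_nat_one_div_lt hε
    obtain ⟨q, hq, hpq⟩ := hPC n x x (mem_of_mem_nhds (hU n x)) p hpP
    filter_upwards [hU n x] with a ha
    refine ⟨q, subset_closure (hCP n x a ha hq), hεO ?_⟩
    rw [Metric.mem_ball, dist_comm]
    exact hpq.trans hn

/-- A subset of a set mapped into a compact metric space has finite `ε`-nets. -/
theorem exists_finite_net {α K : Type*} [MetricSpace K] [CompactSpace K] (e : α → K)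
    (S : Set α) {ε : ℝ} (hε : 0 < ε) :
    ∃ D ⊆ S, D.Finite ∧ ∀ p ∈ S, ∃ q ∈ D, dist (e p) (e q) < ε := by
  have hS : TotallyBounded (e '' S) := isCompact_univ.totallyBounded.subset (subset_univ _)
  obtain ⟨t, htS, htf, hcov⟩ := Metric.finite_approx_of_totallyBounded hS ε hε
  obtain ⟨D, hDS, hDf, rfl⟩ := exists_subset_image_finite_and.1 ⟨t, htS, htf, rfl⟩
  refine ⟨D, hDS, hDf, fun p hp => ?_⟩
  obtain ⟨y, ⟨q, hq, rfl⟩, hy⟩ := mem_iUnion₂.1 (hcov (mem_image_of_mem e hp))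
  exact ⟨q, hq, hy⟩

/-- Let `X` be a zero-dimensional Polish space, `Y` a separable metrizable space, and
`E ⊆ X × Y`. Then `E₀ = {x : dim E(x) = 0}` is reducible to `F₀(E)`: there is a
continuous map `φ : X → F(E)` (for any admissible topology on `F(E)`) with
`E₀ = φ⁻¹(F₀(E))`. -/
theorem E0_reducible_to_F0 {X Y : Type*} [TopologicalSpace X] [PolishSpace X]
    (hX : DimLE X 0) [TopologicalSpace Y] [TopologicalSpace.MetrizableSpace Y]
    [TopologicalSpace.SeparableSpace Y]
    (E : Set (X × Y)) (τ : TopologicalSpace (Cl ↥E)) (hτ : IsAdmissible (↥E) τ) :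
    ∃ φ : X → Cl ↥E, @Continuous _ _ _ τ φ ∧
      {x : X | DimLE (↥{y : Y | (x, y) ∈ E}) 0} = φ ⁻¹' (F0 ↥E) := by
  obtain ⟨K, tK, hcK, hmK, e, -, rfl⟩ := hτ
  let _ : MetricSpace K := metrizableSpaceMetric K
  obtain ⟨U, hUclopen, hUself, hUeq, hUsep⟩ := hX.exists_partition_cells
  choose D hDS hDfin hDnet using fun (n : ℕ) (S : Set X) =>
    exists_finite_net e {p : E | p.1.1 ∈ S} (Nat.one_div_pos_of_nat (α := ℝ) (n := n))
  have hUanti : ∀ n x, ∀ a ∈ U n x, ∀ m ≤ n, a ∈ U m x := fun n x a ha m hm =>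
    hUeq n x a ha m hm ▸ hUself m a
  have hfst : Continuous fun p : E => p.1.1 := continuous_fst.comp continuous_subtype_val
  let P : X → Set E := fun x => {p : E | p.1.1 = x} ∪ ⋃ n, D n (U n x)
  have hlocfin : ∀ x (p : E), p.1.1 ≠ x → ∃ O, IsOpen O ∧ p ∈ O ∧ (O ∩ P x).Finite := by
    intro x p hp
    obtain ⟨n, hn⟩ := hUsep x p.1.1 hp
    refine ⟨{q : E | q.1.1 ∉ U n x}, (hUclopen n x).compl.isOpen.preimage hfst, hn, ?_⟩
    refine ((finite_Iio n).biUnion fun m _ => hDfin m (U m x)).subset ?_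
    rintro q ⟨hq, hqx | hqD⟩
    · have hqx : q.1.1 = x := hqx
      exact absurd (hqx ▸ hUself n q.1.1) hq
    · obtain ⟨m, hm⟩ := mem_iUnion.1 hqD
      refine mem_iUnion₂.2 ⟨m, mem_Iio.2 <| lt_of_not_ge fun hnm => hq ?_, hm⟩
      exact hUanti m x _ (hDS m (U m x) hm) n hnm
  have hPclosed : ∀ x, IsClosed (P x) := by
    refine fun x => isOpen_compl_iff.1 (isOpen_iff_mem_nhds.2 fun p hp => ?_)
    obtain ⟨O, hO, hpO, hfin⟩ := hlocfin x p fun h => hp (Or.inl h)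
    filter_upwards [(hO.sdiff hfin.isClosed).mem_nhds ⟨hpO, fun h => hp h.2⟩] with q hq h
    exact hq.2 ⟨hq.1, h⟩
  refine ⟨fun x => ⟨P x, hPclosed x⟩, continuous_induced_rng.2 ?_, ?_⟩
  · refine continuous_vietoris_of_common_net (fun x => e '' P x)
      (fun n x => e '' ⋃ m ∈ Iic n, D m (U m x)) U
      (fun n x => (hUclopen n x).isOpen.mem_nhds (hUself n x)) ?_ ?_
    · rintro n x a ha - ⟨q, hq, rfl⟩
      obtain ⟨m, hm, hq⟩ := mem_iUnion₂.1 hq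
      rw [← hUeq n x a ha m hm] at hq
      exact mem_image_of_mem e (Or.inr (mem_iUnion.2 ⟨m, hq⟩))
    · have hnear : ∀ n x (p : E), p.1.1 ∈ U n x →
          ∃ q ∈ e '' ⋃ m ∈ Iic n, D m (U m x), dist (e p) q < 1 / ((n : ℝ) + 1) := by
        intro n x p hp
        obtain ⟨q, hq, hpq⟩ := hDnet n (U n x) p hp
        exact ⟨e q, mem_image_of_mem e (mem_iUnion₂.2 ⟨n, mem_Iic.2 le_rfl, hq⟩), hpq⟩
      rintro n x a ha - ⟨p, hp | hp, rfl⟩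
      · have hp : p.1.1 = a := hp
        exact hnear n x p (hp ▸ ha)
      · obtain ⟨m, hm⟩ := mem_iUnion.1 hp
        rcases le_total m n with hmn | hnm
        · rw [hUeq n x a ha m hmn] at hm
          refine ⟨e p, mem_image_of_mem e (mem_iUnion₂.2 ⟨m, hmn, hm⟩), ?_⟩
          rw [dist_self]
          exact Nat.one_div_pos_of_nat
        · refine hnear n x p ?_
          rw [← hUeq n x a ha n le_rfl]
          exact hUanti m a _ (hDS m (U m a) hm) n hnm
  · ext x
    let g : {y : Y | (x, y) ∈ E} → P x := fun y => ⟨⟨(x, y.1), y.2⟩, Or.inl rfl⟩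
    have hrange : range g = {z : P x | z.1.1.1 = x} := by
      ext z
      refine ⟨?_, fun hz => ?_⟩
      · rintro ⟨y, rfl⟩
        rfl
      · obtain ⟨⟨⟨a, y⟩, hy⟩, hz'⟩ := z
        obtain rfl : a = x := hz
        exact ⟨⟨y, hy⟩, rfl⟩
    have hg : IsClosedEmbedding g := by
      refine ⟨?_, ?_⟩
      · have hsnd : Continuous fun z : P x => z.1.1.2 :=
          continuous_snd.comp (continuous_subtype_val.comp continuous_subtype_val)
        refine IsEmbedding.of_comp (by fun_prop) hsnd ?_
        exact IsEmbedding.subtypeVal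
      · rw [hrange]
        exact isClosed_singleton.preimage (hfst.comp continuous_subtype_val)
    refine ⟨fun hx => DimLE.of_isClosedEmbedding_of_isolated (Z := P x) hg hx fun z hz => ?_,
      fun hx => DimLE.of_isClosedEmbedding hg hx⟩
    rw [hrange] at hz
    obtain ⟨O, hO, hzO, hfin⟩ := hlocfin x z.1 hz
    have hfin' : (Subtype.val ⁻¹' O : Set (P x)).Finite :=
      (hfin.preimage Subtype.val_injective.injOn).subset fun q hq => ⟨hq, q.2⟩
    have : ({z} : Set (P x)) = Subtype.val ⁻¹' O \ (Subtype.val ⁻¹' O \ {z}) := by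
      ext q
      simp only [mem_singleton_iff, Set.mem_sdiff, mem_preimage, not_and, not_not]
      exact ⟨fun h => ⟨h ▸ hzO, fun _ => h⟩, fun h => h.2 h.1⟩
    rw [this]
    exact (hO.preimage continuous_subtype_val).sdiff (hfin'.subset sdiff_subset).isClosed
end

section
/- Let X be an analytic space and I a σ-ideal of F(X). (a) If I is Σ¹₁ (analytic) for some admissible topology on F(X), then I is a G_δ subset of F(X) for every admissible topology. (b) If I is Π¹₁ (co-analytic) for some admissible topology, then for every admissible topology I is either a G_δ subset of F(X) or Π¹₁-complete. -/
open Set Filter Topology TopologicalSpace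

section Hyperspace

variable {X Y : Type*} [TopologicalSpace X] [TopologicalSpace Y] {e : X → Y}

/-- The topology on `F(X)` induced by `e : X → Y` from the Vietoris topology on `Set Y`. -/
abbrev hyperTop (e : X → Y) : TopologicalSpace (Cl X) :=
  (vietoris Y).induced fun F : Cl X => closure (e '' F.1)

theorem vietoris_eq : vietoris Y = TopologicalSpace.vietoris Y := by
  unfold vietoris TopologicalSpace.vietoris
  congr 1
  ext S
  simp only [mem_union, mem_ofPred_eq, mem_image]
  constructor
  · rintro (⟨U, hU, rfl⟩ | ⟨U, hU, rfl⟩)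
    · exact Or.inl ⟨U, hU, rfl⟩
    · exact Or.inr ⟨U, hU, rfl⟩
  · rintro (⟨U, hU, rfl⟩ | ⟨U, hU, rfl⟩)
    · exact Or.inl ⟨U, hU, rfl⟩
    · exact Or.inr ⟨U, hU, rfl⟩

theorem hyperTop_eq_induced_compacts [CompactSpace Y] (e : X → Y) :
    hyperTop e = (inferInstance : TopologicalSpace (Compacts Y)).induced
      fun F : Cl X => (⟨closure (e '' F.1), isClosed_closure.isCompact⟩ : Compacts Y) := by
  unfold hyperTop
  rw [vietoris_eq]
  change _ = TopologicalSpace.induced _ (TopologicalSpace.induced _ _)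
  rw [induced_compose]
  rfl

theorem pseudoMetrizableSpace_hyperTop [CompactSpace Y] [MetrizableSpace Y] (e : X → Y) :
    @PseudoMetrizableSpace (Cl X) (hyperTop e) := by
  let := metrizableSpaceMetric Y
  rw [hyperTop_eq_induced_compacts]
  let := (inferInstance : TopologicalSpace (Compacts Y)).induced
      fun F : Cl X => (⟨closure (e '' F.1), isClosed_closure.isCompact⟩ : Compacts Y)
  exact (IsInducing.mk rfl).pseudoMetrizableSpace

theorem secondCountableTopology_hyperTop [CompactSpace Y] [MetrizableSpace Y] (e : X → Y) :
    @SecondCountableTopology (Cl X) (hyperTop e) := by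
  let := metrizableSpaceMetric Y
  rw [hyperTop_eq_induced_compacts]
  exact secondCountableTopology_induced _ _ _

theorem notMem_closure_image (he : IsEmbedding e) {F : Cl X} {p : X} (hp : p ∉ F.1) :
    e p ∉ closure (e '' F.1) := by
  intro h
  have : p ∈ closure F.1 := by rwa [he.isInducing.closure_eq_preimage_closure_image]
  rw [F.2.closure_eq] at this
  exact hp this

variable [τ : TopologicalSpace (Cl X)]

theorem isOpen_hyperTop_subset (hτ : τ = hyperTop e) {V : Set Y} (hV : IsOpen V) :
    IsOpen {F : Cl X | closure (e '' F.1) ⊆ V} := by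
  subst hτ
  exact ⟨{A | A ⊆ V}, isOpen_generateFrom_of_mem (Or.inl ⟨V, hV, rfl⟩), rfl⟩

theorem isOpen_hyperTop_hit (hτ : τ = hyperTop e) {U : Set Y} (hU : IsOpen U) :
    IsOpen {F : Cl X | (e '' F.1 ∩ U).Nonempty} := by
  subst hτ
  refine ⟨{A | (A ∩ U).Nonempty}, isOpen_generateFrom_of_mem (Or.inr ⟨U, hU, rfl⟩), ?_⟩
  ext F
  exact closure_inter_open_nonempty_iff hU

theorem tendsto_hyperTop (hτ : τ = hyperTop e) {ι : Type*} {l : Filter ι} {k : ι → Cl X} {K : Cl X}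
    (h₁ : ∀ V : Set Y, IsOpen V → closure (e '' K.1) ⊆ V → ∀ᶠ i in l, closure (e '' (k i).1) ⊆ V)
    (h₂ : ∀ U : Set Y, IsOpen U → (e '' K.1 ∩ U).Nonempty →
      ∀ᶠ i in l, (e '' (k i).1 ∩ U).Nonempty) :
    Tendsto k l (𝓝 K) := by
  subst hτ
  let := vietoris Y
  rw [nhds_induced, tendsto_comap_iff]
  refine tendsto_nhds_generateFrom_iff.2 ?_
  rintro _ (⟨U, hU, rfl⟩ | ⟨U, hU, rfl⟩) hK
  · exact h₁ U hU hK
  · filter_upwards [h₂ U hU ((closure_inter_open_nonempty_iff hU).1 hK)] with i hi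
    exact (closure_inter_open_nonempty_iff hU).2 hi

theorem exists_nhds_forall_notMem [RegularSpace Y] (he : IsEmbedding e)
    (hτ : τ = hyperTop e) {F : Cl X} {p : X} (hp : p ∉ F.1) :
    ∃ U ∈ 𝓝 p, ∃ O ∈ 𝓝 F, ∀ q ∈ U, ∀ G ∈ O, q ∉ G.1 := by
  obtain ⟨V, hV, W, hW, hVW⟩ := Filter.disjoint_iff.1
    ((disjoint_nhdsSet_nhds (s := closure (e '' F.1)) (x := e p)).2
      (by rw [closure_closure]; exact notMem_closure_image he hp))
  obtain ⟨V', hV', hFV', hV'V⟩ := mem_nhdsSet_iff_exists.1 hV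
  refine ⟨e ⁻¹' W, he.continuous.continuousAt hW, {G | closure (e '' G.1) ⊆ V'},
    (isOpen_hyperTop_subset hτ hV').mem_nhds hFV', fun q hq G hG hqG => ?_⟩
  exact hVW.le_bot ⟨hV'V (hG (subset_closure (mem_image_of_mem e hqG))), hq⟩

theorem exists_nhds_forall_not_subset [RegularSpace Y] (he : IsEmbedding e)
    (hτ : τ = hyperTop e) {L M : Cl X} (h : ¬ L.1 ⊆ M.1) :
    ∃ O ∈ 𝓝 L, ∃ O' ∈ 𝓝 M, ∀ L' ∈ O, ∀ M' ∈ O', ¬ L'.1 ⊆ M'.1 := by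
  obtain ⟨p, hpL, hpM⟩ := not_subset.1 h
  obtain ⟨U, hU, O', hO', hd⟩ := exists_nhds_forall_notMem he hτ hpM
  obtain ⟨W, hWU, hW, hpW⟩ := mem_nhds_iff.1 hU
  obtain ⟨V, hV, rfl⟩ := he.isInducing.isOpen_iff.1 hW
  refine ⟨{F : Cl X | (e '' F.1 ∩ V).Nonempty},
    (isOpen_hyperTop_hit hτ hV).mem_nhds ⟨e p, mem_image_of_mem e hpL, hpW⟩, O', hO', ?_⟩
  rintro L' ⟨_, ⟨q, hq, rfl⟩, hqV⟩ M' hM' hLM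
  exact hd q (hWU hqV) M' hM' (hLM hq)

theorem exists_mem_nhds_iUnion_eq [NormalSpace Y] [R1Space Y] (he : IsEmbedding e)
    (hτ : τ = hyperTop e) {k : ℕ → Cl X} {K : Cl X} (hk : Tendsto k atTop (𝓝 K))
    {O : Set (Cl X)} (hO : O ∈ 𝓝 K) :
    ∃ N, ∃ L ∈ O, L.1 = K.1 ∪ ⋃ n, (k (N + n)).1 := by
  have hcl : ∀ N, IsClosed (K.1 ∪ ⋃ n, (k (N + n)).1) := by
    intro N
    refine isOpen_compl_iff.1 (isOpen_iff_mem_nhds.2 fun p hp => ?_)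
    have hpK : p ∉ K.1 := fun h => hp (Or.inl h)
    have hpk : ∀ n, p ∉ (k (N + n)).1 := fun n h => hp (Or.inr (mem_iUnion.2 ⟨n, h⟩))
    obtain ⟨U, hU, O', hO', hd⟩ := exists_nhds_forall_notMem he hτ hpK
    obtain ⟨M, hM⟩ := eventually_atTop.1 (hk.eventually hO')
    have hfin : ∀ᶠ q in 𝓝 p, ∀ n ∈ Finset.range M, q ∉ (k (N + n)).1 :=
      (Filter.eventually_all_finset _).2 fun n _ => (k (N + n)).2.isOpen_compl.mem_nhds (hpk n)
    filter_upwards [hU, K.2.isOpen_compl.mem_nhds hpK, hfin] with q hq hqK hqM hqL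
    rcases hqL with hqL | hqL
    · exact hqK hqL
    · obtain ⟨n, hn⟩ := mem_iUnion.1 hqL
      by_cases hnM : n < M
      · exact hqM n (Finset.mem_range.2 hnM) hn
      · exact hd q hq _ (hM (N + n) (by omega)) hn
  have hL : Tendsto (fun N => (⟨_, hcl N⟩ : Cl X)) atTop (𝓝 K) := by
    refine tendsto_hyperTop hτ (fun V hV hKV => ?_) fun U hU hKU => ?_
    · obtain ⟨V', hV', hKV', hV'V⟩ := normal_exists_closure_subset isClosed_closure hV hKV
      obtain ⟨N, hN⟩ := eventually_atTop.1 (hk.eventually ((isOpen_hyperTop_subset hτ hV').mem_nhds hKV'))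
      filter_upwards [eventually_ge_atTop N] with n hn
      refine (closure_mono ?_).trans hV'V
      rw [image_union, image_iUnion]
      refine union_subset (subset_closure.trans hKV') (iUnion_subset fun m => ?_)
      exact subset_closure.trans (hN (n + m) (by omega))
    · exact Eventually.of_forall fun n => hKU.mono (inter_subset_inter_left _ (image_mono subset_union_left))
  obtain ⟨N, hN⟩ := (hL.eventually hO).exists
  exact ⟨N, _, hN, rfl⟩

end Hyperspace

theorem analyticSet_hyperTop_congr {X Y Z : Type*} [TopologicalSpace X]
    [TopologicalSpace Y] [TopologicalSpace Z] [CompactSpace Z] [MetrizableSpace Z]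
    {e : X → Y} {e' : X → Z} (he : IsEmbedding e) (he' : IsEmbedding e') {A : Set (Cl X)}
    (hA : @MeasureTheory.AnalyticSet _ (hyperTop e) A) :
    @MeasureTheory.AnalyticSet _ (hyperTop e') A := by
  rw [@MeasureTheory.AnalyticSet_def (Cl X) (hyperTop e)] at hA
  obtain rfl | ⟨f, hf, rfl⟩ := hA
  · exact @MeasureTheory.analyticSet_empty _ (hyperTop e')
  let := metrizableSpaceMetric Z
  have hit (U : Set Z) (hU : IsOpen U) :
      IsOpen {y | (e' '' (f y).1 ∩ U).Nonempty} := by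
    obtain ⟨V, hV, hVU⟩ := he.isInducing.isOpen_iff.1 (hU.preimage he'.continuous)
    let := hyperTop e
    convert (isOpen_hyperTop_hit (e := e) rfl hV).preimage hf using 1
    ext y
    simp only [image_inter_nonempty_iff, mem_preimage, mem_ofPred_eq, hVU]
  let := hyperTop e'
  let : MeasurableSpace (Cl X) := borel _
  have : BorelSpace (Cl X) := ⟨rfl⟩
  have : SecondCountableTopology (Cl X) := secondCountableTopology_hyperTop e'
  suffices Measurable f by
    simpa using (MeasurableSet.univ.analyticSet_image this)
  have hgen : hyperTop e' = generateFrom _ := induced_generateFrom_eq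
  have hb := borel_eq_generateFrom_of_subbasis hgen
  change @Measurable _ _ _ (borel (Cl X)) f
  rw [hb]
  refine measurable_generateFrom ?_
  rintro _ ⟨_, ⟨U, hU, rfl⟩ | ⟨U, hU, rfl⟩, rfl⟩
  · have : f ⁻¹' ((fun F : Cl X => closure (e' '' F.1)) ⁻¹' {A | A ⊆ U}) =
        ⋃ n : ℕ, {y | (e' '' (f y).1 ∩ Metric.thickening (1 / (n + 1 : ℝ)) Uᶜ).Nonempty}ᶜ := by
      ext y
      simp only [mem_preimage, mem_ofPred_eq, mem_iUnion, mem_compl_iff]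
      constructor
      · intro h
        obtain ⟨δ, hδ, hd⟩ := (disjoint_compl_right_iff_subset.2 h).exists_thickenings
          isClosed_closure.isCompact hU.isClosed_compl
        obtain ⟨n, hn⟩ := exists_nat_one_div_lt hδ
        refine ⟨n, fun ⟨p, hp, hpn⟩ => hd.le_bot
          ⟨Metric.self_subset_thickening hδ _ (subset_closure hp),
            Metric.thickening_mono hn.le _ hpn⟩⟩
      · rintro ⟨n, hn⟩
        rw [← not_disjoint_iff_nonempty_inter, not_not] at hn
        exact disjoint_compl_right_iff_subset.1 ((hn.closure_left Metric.isOpen_thickening).mono_right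
          (Metric.self_subset_thickening (by positivity) _))
    rw [this]
    exact MeasurableSet.iUnion fun n => (hit _ Metric.isOpen_thickening).measurableSet.compl
  · convert (hit U hU).measurableSet using 1
    ext y
    exact closure_inter_open_nonempty_iff hU

theorem exists_res_subset_of_mem_nhds {x : ℕ → ℕ} {U : Set (ℕ → ℕ)} (hU : U ∈ 𝓝 x) :
    ∃ n, ∀ y, PiNat.res y n = PiNat.res x n → y ∈ U := by
  obtain ⟨_, ⟨z, n, rfl⟩, hx, hU⟩ := (PiNat.isTopologicalBasis_cylinders _).mem_nhds_iff.1 hU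
  refine ⟨n, fun y hy => hU ?_⟩
  rw [PiNat.cylinder_eq_res] at hx ⊢
  exact hy.trans hx

section SigmaIdeal

variable {X Y : Type*} [TopologicalSpace X] [TopologicalSpace Y] {e : X → Y}
  [τ : TopologicalSpace (Cl X)] {I : Set (Cl X)}

theorem exists_mem_sigmaIdeal_nhds_forall_subset [CompactSpace Y] [MetrizableSpace Y]
    (he : IsEmbedding e) (hτ : τ = hyperTop e)
    (hideal : ∀ (F : Cl X) (A : ℕ → Cl X), (∀ n, A n ∈ I) → F.1 ⊆ ⋃ n, (A n).1 → F ∈ I)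
    {k : ℕ → Cl X} {K : Cl X} (hkI : ∀ n, k n ∈ I) (hK : K ∈ I)
    (hk : Tendsto k atTop (𝓝 K)) {O : Set (Cl X)} (hO : O ∈ 𝓝 K) :
    ∃ L ∈ I, L ∈ O ∧ ∀ᶠ n in atTop, (k n).1 ⊆ L.1 := by
  obtain ⟨N, L, hLO, hL⟩ := exists_mem_nhds_iUnion_eq he hτ hk hO
  refine ⟨L, hideal L (fun n => n.casesOn K fun n => k (N + n)) ?_ ?_, hLO, ?_⟩
  · rintro (_ | n)
    exacts [hK, hkI _]
  · rw [hL]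
    exact union_subset (subset_iUnion_of_subset 0 subset_rfl)
      (iUnion_subset fun n => subset_iUnion_of_subset (n + 1) subset_rfl)
  · filter_upwards [eventually_ge_atTop N] with n hn
    rw [hL]
    obtain ⟨m, rfl⟩ := Nat.exists_eq_add_of_le hn
    exact (subset_iUnion (fun n => (k (N + n)).1) m).trans subset_union_right

/-- Every sequence in `I` converging to `K` is eventually contained in a single `f y` with
`y` extending `s`. -/
def AbsorbsAt (I : Set (Cl X)) (f : (ℕ → ℕ) → Cl X) (s : List ℕ) (K : Cl X) : Prop :=
  ∀ k : ℕ → Cl X, (∀ n, k n ∈ I) → Tendsto k atTop (𝓝 K) →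
    ∃ y, PiNat.res y s.length = s ∧ ∀ᶠ n in atTop, (k n).1 ⊆ (f y).1

theorem AbsorbsAt.exists_cons [CompactSpace Y] [MetrizableSpace Y] [FirstCountableTopology (Cl X)]
    (he : IsEmbedding e) (hτ : τ = hyperTop e)
    (hideal : ∀ (F : Cl X) (A : ℕ → Cl X), (∀ n, A n ∈ I) → F.1 ⊆ ⋃ n, (A n).1 → F ∈ I)
    {f : (ℕ → ℕ) → Cl X} {s : List ℕ} {K : Cl X} (hK : K ∈ I) (h : AbsorbsAt I f s K) :
    ∃ m, AbsorbsAt I f (m :: s) K := by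
  by_contra! hn
  unfold AbsorbsAt at hn
  push Not at hn
  choose k hkI hk hy using hn
  obtain ⟨O, hO⟩ := (𝓝 K).exists_antitone_basis
  choose L hLI hLO hkL using fun i : ℕ => exists_mem_sigmaIdeal_nhds_forall_subset he hτ hideal
    (hkI i.unpair.1) hK (hk i.unpair.1) (hO.mem i)
  obtain ⟨y, hys, hyL⟩ := h L hLI (hO.tendsto hLO)
  obtain ⟨N, hN⟩ := eventually_atTop.1 hyL
  have hi : ((Nat.pair (y s.length) N).unpair.1) = y s.length := by simp
  have h1 := hkL (Nat.pair (y s.length) N)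
  rw [hi] at h1
  refine hy (y s.length) y (by simp [hys]) (h1.mono fun n hn => not_not.2 (hn.trans ?_))
  exact hN _ (Nat.right_le_pair _ _)

theorem AbsorbsAt.notMem_closure [CompactSpace Y] [MetrizableSpace Y]
    [FirstCountableTopology (Cl X)] (he : IsEmbedding e) (hτ : τ = hyperTop e)
    (hideal : ∀ (F : Cl X) (A : ℕ → Cl X), (∀ n, A n ∈ I) → F.1 ⊆ ⋃ n, (A n).1 → F ∈ I)
    {f : (ℕ → ℕ) → Cl X} {s : List ℕ} {K : Cl X} (h : AbsorbsAt I f s K) :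
    K ∉ closure {L ∈ I | ¬ AbsorbsAt I f s L} := by
  intro hcl
  obtain ⟨O, hO⟩ := (𝓝 K).exists_antitone_basis
  have hne (j : ℕ) : ∃ L ∈ I, L ∈ O j ∧ ∀ y, PiNat.res y s.length = s → ¬ L.1 ⊆ (f y).1 := by
    obtain ⟨M, hMO, hMI, hM⟩ := mem_closure_iff_nhds.1 hcl _ (interior_mem_nhds.2 (hO.mem j))
    unfold AbsorbsAt at hM
    push Not at hM
    obtain ⟨k, hkI, hk, hy⟩ := hM
    obtain ⟨L, hL, hLO, hkL⟩ := exists_mem_sigmaIdeal_nhds_forall_subset he hτ hideal hkI hMI hk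
      (isOpen_interior.mem_nhds hMO)
    exact ⟨L, hL, interior_subset hLO, fun y hys hLy =>
      hy y hys (hkL.mono fun n hn => not_not.2 (hn.trans hLy))⟩
  choose L hLI hLO hL using hne
  obtain ⟨y, hys, hy⟩ := h L hLI (hO.tendsto hLO)
  obtain ⟨n, hn⟩ := hy.exists
  exact hL n y hys hn

theorem isGδ_sigmaIdeal_of_analyticSet [CompactSpace Y] [MetrizableSpace Y]
    (he : IsEmbedding e) (hτ : τ = hyperTop e)
    (hideal : ∀ (F : Cl X) (A : ℕ → Cl X), (∀ n, A n ∈ I) → F.1 ⊆ ⋃ n, (A n).1 → F ∈ I)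
    (hI : MeasureTheory.AnalyticSet I) : IsGδ I := by
  have : PseudoMetrizableSpace (Cl X) := hτ ▸ pseudoMetrizableSpace_hyperTop e
  let := pseudoMetrizableSpacePseudoMetric (Cl X)
  rw [MeasureTheory.AnalyticSet] at hI
  obtain rfl | ⟨f, hf, hfI⟩ := hI
  · exact IsGδ.empty
  let V : List ℕ → Set (Cl X) := fun s => (closure {L ∈ I | ¬ AbsorbsAt I f s L})ᶜ
  have hV (s) : IsOpen (V s) := isClosed_closure.isOpen_compl
  have hVI (s) (K) (hK : K ∈ I) (hKV : K ∈ V s) : AbsorbsAt I f s K := by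
    by_contra h
    exact hKV (subset_closure ⟨hK, h⟩)
  have hIV (s) (K) (h : AbsorbsAt I f s K) : K ∈ V s := h.notMem_closure he hτ hideal
  have key : I = closure I ∩ V [] ∩ ⋂ s, ((V s)ᶜ ∪ ⋃ m, V (m :: s)) := by
    apply Subset.antisymm
    · intro K hK
      refine ⟨⟨subset_closure hK, hIV _ _ fun k hkI hk => ?_⟩, mem_iInter.2 fun s => ?_⟩
      · obtain ⟨L, hL, -, hkL⟩ := exists_mem_sigmaIdeal_nhds_forall_subset he hτ hideal hkI hK hk
          univ_mem
        rw [← hfI] at hL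
        obtain ⟨y, rfl⟩ := hL
        exact ⟨y, rfl, hkL⟩
      · by_cases hKs : K ∈ V s
        · obtain ⟨m, hm⟩ := (hVI s K hK hKs).exists_cons he hτ hideal hK
          exact Or.inr (mem_iUnion.2 ⟨m, hIV _ _ hm⟩)
        · exact Or.inl hKs
    · rintro L ⟨⟨hLI, hL0⟩, hL⟩
      have hstep (s) (hs : L ∈ V s) : ∃ m, L ∈ V (m :: s) :=
        mem_iUnion.1 ((mem_iInter.1 hL s).resolve_left (not_not.2 hs))
      choose! m hm using hstep
      let S : ℕ → List ℕ := fun n => Nat.rec [] (fun _ s => m s :: s) n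
      let x : ℕ → ℕ := fun n => m (S n)
      have hxS (n) : PiNat.res x n = S n := by
        induction n with
        | zero => rfl
        | succ n ih => rw [PiNat.res_succ, ih]
      have hLS (n) : L ∈ V (S n) := by
        induction n with
        | zero => exact hL0
        | succ n ih => exact hm _ ih
      by_contra hLn
      have hLf : ¬ L.1 ⊆ (f x).1 := fun h => hLn <|
        hideal L (fun _ => f x) (fun _ => hfI ▸ mem_range_self x) (h.trans (subset_iUnion
          (fun _ : ℕ => (f x).1) 0))
      obtain ⟨O, hO, O', hO', hd⟩ := exists_nhds_forall_not_subset he hτ hLf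
      obtain ⟨n, hn⟩ := exists_res_subset_of_mem_nhds (hf.continuousAt hO')
      obtain ⟨M, ⟨hMO, hMV⟩, hMI⟩ := mem_closure_iff_nhds.1 hLI _
        (inter_mem hO ((hV (S n)).mem_nhds (hLS n)))
      obtain ⟨y, hy, hMy⟩ := hVI _ _ hMI hMV (fun _ => M) (fun _ => hMI) tendsto_const_nhds
      rw [← hxS, PiNat.res_length] at hy
      exact hd M hMO (f y) (hn y hy) hMy.exists.choose_spec
  rw [key]
  exact (isClosed_closure.isGδ.inter (hV _).isGδ).inter <| IsGδ.iInter fun s =>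
    (hV s).isClosed_compl.isGδ.union (isOpen_iUnion fun m => hV _).isGδ

end SigmaIdeal

section Hardness

theorem exists_cons_suffix {α : Type*} {s t : List α} (h : s <:+ t) (hne : t ≠ s) :
    ∃ m, (m :: s) <:+ t := by
  obtain ⟨p, rfl⟩ := h
  obtain rfl | ⟨q, m, rfl⟩ := p.eq_nil_or_concat
  · exact absurd rfl hne
  · exact ⟨m, q, by simp⟩

/-- A form of König's lemma along a filter. -/
theorem exists_forall_frequently_res {Z : Type*} {l : Filter Z} {R : Z → List ℕ → Prop}
    (h₀ : ∃ᶠ z in l, ∃ t, R z t)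
    (h : ∀ s, (∃ᶠ z in l, ∃ t, s <:+ t ∧ R z t) →
      ∃ M, ∀ᶠ z in l, ∀ t, R z t → s <:+ t → ∃ m < M, (m :: s) <:+ t) :
    ∃ x : ℕ → ℕ, ∀ n, ∃ᶠ z in l, ∃ t, PiNat.res x n <:+ t ∧ R z t := by
  have hstep (s) (hs : ∃ᶠ z in l, ∃ t, s <:+ t ∧ R z t) :
      ∃ m, ∃ᶠ z in l, ∃ t, (m :: s) <:+ t ∧ R z t := by
    obtain ⟨M, hM⟩ := h s hs
    by_contra! hn
    have hfin : ∀ᶠ z in l, ∀ m ∈ Finset.range M, ¬ ∃ t, (m :: s) <:+ t ∧ R z t :=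
      (Filter.eventually_all_finset _).2 fun m _ =>
        (hn m).mono fun z hz ⟨t, hmt, ht⟩ => hz t hmt ht
    obtain ⟨z, ⟨⟨t, hst, ht⟩, hz⟩, hzn⟩ := ((hs.and_eventually hM).and_eventually hfin).exists
    obtain ⟨m, hm, hmt⟩ := hz t ht hst
    exact hzn m (Finset.mem_range.2 hm) ⟨t, hmt, ht⟩
  choose! m hm using hstep
  let S : ℕ → List ℕ := fun n => Nat.rec [] (fun _ s => m s :: s) n
  have hS (n) : PiNat.res (fun n => m (S n)) n = S n := by
    induction n with
    | zero => rfl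
    | succ n ih => rw [PiNat.res_succ, ih]
  refine ⟨fun n => m (S n), fun n => ?_⟩
  rw [hS]
  induction n with
  | zero => exact h₀.mono fun z ⟨t, ht⟩ => ⟨t, List.nil_suffix, ht⟩
  | succ n ih => exact hm _ ih

theorem exists_nonempty_forall_mem_closure_image {W : Type*} [TopologicalSpace W] {I : Set W}
    (hI : ¬ IsGδ I) {f : (ℕ → ℕ) → W} (hfI : range f = Iᶜ) :
    ∃ T : Set (ℕ → ℕ), T.Nonempty ∧ ∀ y ∈ T, ∀ U ∈ 𝓝 y, ∃ b ∈ I, b ∈ closure (f '' (U ∩ T)) := by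
  let Small : Set (ℕ → ℕ) → Prop := fun A => ∃ G, IsGδ G ∧ I ⊆ G ∧ Disjoint (f '' A) G
  let T : Set (ℕ → ℕ) := {y | ∀ U ∈ 𝓝 y, ¬ Small U}
  have hT : Small Tᶜ := by
    have hy : ∀ y ∈ Tᶜ, ∃ U ∈ 𝓝 y, Small U := fun y hy => by
      simpa only [T, mem_compl_iff, mem_ofPred_eq, not_forall, not_not, exists_prop] using hy
    choose! U hU G hG hIG hd using hy
    obtain ⟨t, htT, ht, hcov⟩ := countable_cover_nhdsWithin (s := Tᶜ) (f := U) fun y hy =>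
      mem_nhdsWithin_of_mem_nhds (hU y hy)
    refine ⟨⋂ y ∈ t, G y, IsGδ.biInter ht fun y hy => hG y (htT hy),
      subset_iInter₂ fun y hy => hIG y (htT hy), disjoint_left.2 ?_⟩
    rintro _ ⟨w, hw, rfl⟩ hwG
    obtain ⟨y, hyt, hwy⟩ := mem_iUnion₂.1 (hcov hw)
    exact disjoint_left.1 (hd y (htT hyt)) (mem_image_of_mem f hwy) (mem_iInter₂.1 hwG y hyt)
  obtain ⟨G, hG, hIG, hd⟩ := hT
  refine ⟨T, ?_, fun y hy U hU => ?_⟩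
  · by_contra hne
    rw [not_nonempty_iff_eq_empty.1 hne, compl_empty, image_univ, hfI] at hd
    exact hI (hIG.antisymm (disjoint_compl_left_iff_subset.1 hd) ▸ hG)
  · by_contra! hb
    refine hy U hU ⟨G ∩ (closure (f '' (U ∩ T)))ᶜ, hG.inter isClosed_closure.isOpen_compl.isGδ,
      subset_inter hIG hb, disjoint_left.2 ?_⟩
    rintro _ ⟨w, hw, rfl⟩ hwG
    by_cases hwT : w ∈ T
    · exact hwG.2 (subset_closure (mem_image_of_mem f ⟨hw, hwT⟩))
    · exact disjoint_left.1 hd (mem_image_of_mem f hwT) hwG.1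

theorem exists_scheme {W : Type*} [TopologicalSpace W] [RegularSpace W]
    [FirstCountableTopology W] {I : Set W} (hI : ¬ IsGδ I) {f : (ℕ → ℕ) → W} (hf : Continuous f)
    (hfI : range f = Iᶜ) :
    ∃ b : List ℕ → W, (∀ s, b s ∈ I) ∧
      (∀ s, ∀ O ∈ 𝓝 (b s), ∀ᶠ m in atTop, ∀ t, (m :: s) <:+ t → b t ∈ O) ∧
      ∀ x : ℕ → ℕ, ∃ φ ∉ I, ∀ O ∈ 𝓝 φ, ∀ᶠ n in atTop, ∀ t, PiNat.res x n <:+ t → b t ∈ O := by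
  obtain ⟨T, ⟨y₀, hy₀⟩, hT⟩ := exists_nonempty_forall_mem_closure_image hI hfI
  have hcyl (y : ℕ → ℕ) (k : ℕ) : PiNat.cylinder y k ∈ 𝓝 y :=
    (PiNat.isOpen_cylinder _ y k).mem_nhds (PiNat.self_mem_cylinder y k)
  have hβ (p : T × ℕ) : ∃ b ∈ I, b ∈ closure (f '' (PiNat.cylinder p.1.1 p.2 ∩ T)) :=
    hT p.1 p.1.2 _ (hcyl _ _)
  choose β hβI hβ using hβ
  choose U hU using fun p => (𝓝 (β p)).exists_antitone_basis
  have hc (p : T × ℕ) (m : ℕ) : ∃ q : T × ℕ, q.1.1 ∈ PiNat.cylinder p.1.1 p.2 ∧ p.2 < q.2 ∧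
      ∀ w ∈ PiNat.cylinder q.1.1 q.2, f w ∈ U p m := by
    obtain ⟨_, hO, y, ⟨hy, hyT⟩, rfl⟩ := mem_closure_iff.1 (hβ p) _ isOpen_interior
      (mem_interior_iff_mem_nhds.2 ((hU p).mem m))
    obtain ⟨n, hn⟩ := exists_res_subset_of_mem_nhds
      (hf.continuousAt (mem_interior_iff_mem_nhds.1 hO))
    refine ⟨(⟨y, hyT⟩, n + (p.2 + 1)), hy, by simp only; omega, fun w hw => hn w ?_⟩
    exact PiNat.res_eq_res.2 fun i hi => hw i (by simp only; omega)
  choose c hc hck hcU using hc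
  let node : List ℕ → T × ℕ := fun s => List.rec (⟨y₀, hy₀⟩, 0) (fun m _ p => c p m) s
  let C : List ℕ → Set (ℕ → ℕ) := fun s => PiNat.cylinder (node s).1.1 (node s).2
  have hCc (m s) : C (m :: s) ⊆ C s := fun w hw i hi =>
    (hw i (hi.trans (hck _ _))).trans (hc _ _ i hi)
  have hC {s t} (h : s <:+ t) : C t ⊆ C s := by
    obtain ⟨p, rfl⟩ := h
    induction p with
    | nil => exact subset_rfl
    | cons m p ih => exact (hCc m (p ++ s)).trans ih
  have hself (s) : (node s).1.1 ∈ C s := PiNat.self_mem_cylinder _ _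
  have hb {s O} (hO : IsClosed O) (hs : ∀ w ∈ C s, f w ∈ O) : β (node s) ∈ O :=
    closure_minimal (image_subset_iff.2 fun w hw => hs w hw.1) hO (hβ (node s))
  refine ⟨fun s => β (node s), fun s => hβI _, fun s O hO => ?_, fun x => ?_⟩
  · obtain ⟨O', hO', hcl, hsub⟩ := exists_mem_nhds_isClosed_subset hO
    filter_upwards [(hU (node s)).eventually_subset hO'] with m hm t ht
    exact hsub (hb hcl fun w hw => hm (hcU _ _ w (hC ht hw)))
  · have hk (n) : n ≤ (node (PiNat.res x n)).2 := by
      induction n with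
      | zero => exact Nat.zero_le _
      | succ n ih => exact ih.trans_lt (hck _ _)
    have hsuf {m n} (h : m ≤ n) : PiNat.res x m <:+ PiNat.res x n := by
      induction n, h using Nat.le_induction with
      | base => exact List.suffix_rfl
      | succ n _ ih => exact ih.trans (List.suffix_cons _ _)
    let y : ℕ → ℕ := fun i => (node (PiNat.res x (i + 1))).1.1 i
    have hy (n) : y ∈ C (PiNat.res x n) := by
      intro i hi
      obtain h | h := le_total n (i + 1)
      · have := hC (hsuf h) (hself (PiNat.res x (i + 1)))
        exact this i hi
      · have := hC (hsuf h) (hself (PiNat.res x n))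
        exact (this i (hk (i + 1))).symm
    refine ⟨f y, fun h => ?_, fun O hO => ?_⟩
    · exact (hfI ▸ mem_range_self y : f y ∈ Iᶜ) h
    · obtain ⟨O', hO', hcl, hsub⟩ := exists_mem_nhds_isClosed_subset hO
      obtain ⟨n, hn⟩ := exists_res_subset_of_mem_nhds (hf.continuousAt hO')
      filter_upwards [eventually_ge_atTop n] with N hN t ht
      refine hsub (hb hcl fun w hw => hn w (PiNat.res_eq_res.2 fun i hi => ?_))
      have hi' := hi.trans_le (hN.trans (hk N))
      exact (hC ht hw i hi').trans (hy N i hi').symm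

variable {X Y : Type*} [TopologicalSpace X] [TopologicalSpace Y] {e : X → Y}
  {I : Set (Cl X)} {b : List ℕ → Cl X}

/-- The closed set attached to a tree `S` by a family `b` of closed sets. -/
def treeUnion (b : List ℕ → Cl X) (S : Set (List ℕ)) : Cl X :=
  ⟨closure (⋃ s ∈ S, (b s).1), isClosed_closure⟩

theorem subset_treeUnion {S : Set (List ℕ)} {s : List ℕ} (hs : s ∈ S) :
    (b s).1 ⊆ (treeUnion b S).1 :=
  (subset_biUnion_of_mem (u := fun s => (b s).1) hs).trans subset_closure

variable [τ : TopologicalSpace (Cl X)]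

theorem subset_treeUnion_of_branch [RegularSpace Y] (he : IsEmbedding e) (hτ : τ = hyperTop e)
    {S : Set (List ℕ)} {x : ℕ → ℕ} (hx : ∀ n, PiNat.res x n ∈ S) {φ : Cl X}
    (hφ : ∀ O ∈ 𝓝 φ, ∀ᶠ n in atTop, ∀ t, PiNat.res x n <:+ t → b t ∈ O) :
    φ.1 ⊆ (treeUnion b S).1 := by
  by_contra h
  obtain ⟨O, hO, O', hO', hd⟩ := exists_nhds_forall_not_subset he hτ h
  obtain ⟨n, hn⟩ := (hφ O hO).exists
  exact hd _ (hn _ List.suffix_rfl) _ (mem_of_mem_nhds hO') (subset_treeUnion (hx n))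

theorem continuous_treeUnion [CompactSpace Y] [MetrizableSpace Y] (he : IsEmbedding e)
    (hτ : τ = hyperTop e)
    (hb : ∀ s, ∀ O ∈ 𝓝 (b s), ∀ᶠ m in atTop, ∀ t, (m :: s) <:+ t → b t ∈ O)
    (hlim : ∀ x : ℕ → ℕ, ∃ φ : Cl X, ∀ O ∈ 𝓝 φ, ∀ᶠ n in atTop, ∀ t, PiNat.res x n <:+ t → b t ∈ O)
    {Z : Type*} [TopologicalSpace Z] {S : Z → Set (List ℕ)} (hS : ∀ s, IsClopen {z | s ∈ S z})
    (hsuf : ∀ z s t, s <:+ t → t ∈ S z → s ∈ S z) :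
    Continuous fun z => treeUnion b (S z) := by
  refine continuous_iff_continuousAt.2 fun z => tendsto_hyperTop hτ (fun V hV hz => ?_) ?_
  · obtain ⟨V', hV', hzV', hV'V⟩ := normal_exists_closure_subset isClosed_closure hV hz
    have hO : IsOpen {F : Cl X | closure (e '' F.1) ⊆ V'} := isOpen_hyperTop_subset hτ hV'
    suffices h : ∀ᶠ z' in 𝓝 z, ∀ t, ¬ (t ∈ S z' ∧ ¬ closure (e '' (b t).1) ⊆ V') by
      filter_upwards [h] with z' hz'
      refine (closure_minimal ?_ isClosed_closure).trans hV'V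
      refine (image_closure_subset_closure_image he.continuous).trans (closure_mono ?_)
      rw [image_iUnion₂]
      exact iUnion₂_subset fun t ht => subset_closure.trans <|
        not_not.1 fun h => hz' t ⟨ht, h⟩
    by_contra hbad
    have hSz (s) (hs : ∃ᶠ z' in 𝓝 z, ∃ t, s <:+ t ∧ t ∈ S z' ∧ ¬ closure (e '' (b t).1) ⊆ V') :
        s ∈ S z := by
      by_contra h
      obtain ⟨z', ⟨t, hst, ht, -⟩, hz'⟩ :=
        (hs.and_eventually ((hS s).isClosed.isOpen_compl.mem_nhds h)).exists
      exact hz' (hsuf _ _ _ hst ht)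
    have hsub {F : Cl X} (hF : F.1 ⊆ (treeUnion b (S z)).1) : closure (e '' F.1) ⊆ V' :=
      (closure_mono (image_mono hF)).trans hzV'
    obtain ⟨x, hx⟩ := exists_forall_frequently_res (l := 𝓝 z)
      (R := fun z' t => t ∈ S z' ∧ ¬ closure (e '' (b t).1) ⊆ V')
      (by simpa only [Filter.Frequently, not_exists] using hbad) fun s hs => by
        have hsV := hsub (subset_treeUnion (hSz s hs))
        obtain ⟨M, hM⟩ := eventually_atTop.1 (hb s _ (hO.mem_nhds hsV))
        refine ⟨M, Eventually.of_forall fun z' t ht hst => ?_⟩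
        obtain ⟨m, hm⟩ := exists_cons_suffix hst (by rintro rfl; exact ht.2 hsV)
        exact ⟨m, not_le.1 fun h => ht.2 (hM m h t hm), hm⟩
    obtain ⟨φ, hφ⟩ := hlim x
    obtain ⟨n, hn⟩ := (hφ _ (hO.mem_nhds
      (hsub (subset_treeUnion_of_branch he hτ (fun n => hSz _ (hx n)) hφ)))).exists
    obtain ⟨z', t, hnt, -, ht⟩ := (hx n).exists
    exact ht (hn t hnt)
  · rintro U hU ⟨_, ⟨p, hp, rfl⟩, hpU⟩
    obtain ⟨q, hq, hqS⟩ := mem_closure_iff.1 hp _ (hU.preimage he.continuous) hpU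
    obtain ⟨s, hs, hqs⟩ := mem_iUnion₂.1 hqS
    filter_upwards [(hS s).isOpen.mem_nhds hs] with z' hz'
    exact ⟨e q, mem_image_of_mem e (subset_treeUnion hz' hqs), hq⟩

theorem treeUnion_subset [RegularSpace Y] (he : IsEmbedding e) (hτ : τ = hyperTop e)
    (hb : ∀ s, ∀ O ∈ 𝓝 (b s), ∀ᶠ m in atTop, ∀ t, (m :: s) <:+ t → b t ∈ O)
    {S : Set (List ℕ)} (hsuf : ∀ s t, s <:+ t → t ∈ S → s ∈ S)
    (hS : ¬ ∃ x : ℕ → ℕ, ∀ n, PiNat.res x n ∈ S) :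
    (treeUnion b S).1 ⊆ ⋃ s ∈ S, (b s).1 := by
  intro p hp
  by_contra hpS
  have hSs (s) (hs : ∃ᶠ q in 𝓝 p, ∃ t, s <:+ t ∧ t ∈ S ∧ q ∈ (b t).1) : s ∈ S := by
    obtain ⟨q, t, hst, ht, -⟩ := hs.exists
    exact hsuf _ _ hst ht
  obtain ⟨x, hx⟩ := exists_forall_frequently_res (l := 𝓝 p) (R := fun q t => t ∈ S ∧ q ∈ (b t).1)
    ((mem_closure_iff_frequently.1 hp).mono fun q hq => by simpa using hq) fun s hs => by
      have hps : p ∉ (b s).1 := fun h => hpS (mem_biUnion (hSs s hs) h)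
      obtain ⟨U, hU, O, hO, hd⟩ := exists_nhds_forall_notMem he hτ hps
      obtain ⟨M, hM⟩ := eventually_atTop.1 (hb s O hO)
      refine ⟨M, ?_⟩
      filter_upwards [hU] with q hq t ht hst
      obtain ⟨m, hm⟩ := exists_cons_suffix hst
        (by rintro rfl; exact hd q hq _ (mem_of_mem_nhds hO) ht.2)
      exact ⟨m, not_le.1 fun h => hd q hq _ (hM m h t hm) ht.2, hm⟩
  exact hS ⟨x, fun n => hSs _ (hx n)⟩

/-- The tree of initial segments of points `y` for which `g y` agrees with `z` on the
corresponding coordinates. -/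
def agreeTree (g : (ℕ → ℕ) → ℕ → Bool) (z : ℕ → Bool) : Set (List ℕ) :=
  {s | ∃ y, PiNat.res y s.length = s ∧ ∀ i < s.length, g y i = z i}

theorem isClopen_setOf_mem_agreeTree (g : (ℕ → ℕ) → ℕ → Bool) (s : List ℕ) :
    IsClopen {z | s ∈ agreeTree g z} := by
  have key (z z' : ℕ → Bool) (h : z' ∈ PiNat.cylinder z s.length) (hz : s ∈ agreeTree g z) :
      s ∈ agreeTree g z' := by
    obtain ⟨y, hy, hyz⟩ := hz
    exact ⟨y, hy, fun i hi => (hyz i hi).trans (h i hi).symm⟩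
  have hn (z : ℕ → Bool) : PiNat.cylinder z s.length ∈ 𝓝 z :=
    (PiNat.isOpen_cylinder _ _ _).mem_nhds (PiNat.self_mem_cylinder _ _)
  refine ⟨isOpen_compl_iff.1 (isOpen_iff_mem_nhds.2 fun z hz => ?_),
    isOpen_iff_mem_nhds.2 fun z hz => ?_⟩
  · filter_upwards [hn z] with z' hz' h
    exact hz (key z' z ((PiNat.mem_cylinder_comm _ _ _).1 hz') h)
  · filter_upwards [hn z] with z' hz'
    exact key z z' hz' hz

theorem mem_agreeTree_of_suffix {g : (ℕ → ℕ) → ℕ → Bool} {z : ℕ → Bool} {s t : List ℕ}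
    (h : s <:+ t) (ht : t ∈ agreeTree g z) : s ∈ agreeTree g z := by
  obtain ⟨p, rfl⟩ := h
  induction p with
  | nil => exact ht
  | cons m p ih =>
    refine ih ?_
    obtain ⟨y, hy, hyz⟩ := ht
    exact ⟨y, (List.cons.inj hy).2, fun i hi => hyz i (Nat.lt_succ_of_lt hi)⟩

theorem exists_branch_agreeTree_iff {g : (ℕ → ℕ) → ℕ → Bool} (hg : Continuous g) {z : ℕ → Bool} :
    (∃ x : ℕ → ℕ, ∀ n, PiNat.res x n ∈ agreeTree g z) ↔ z ∈ range g := by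
  constructor
  · rintro ⟨x, hx⟩
    refine ⟨x, funext fun i => ?_⟩
    have hO : {w : ℕ → Bool | w i = g x i} ∈ 𝓝 (g x) :=
      (continuous_apply i).continuousAt.preimage_mem_nhds ((isOpen_discrete {g x i}).mem_nhds rfl)
    obtain ⟨n, hn⟩ := exists_res_subset_of_mem_nhds (hg.continuousAt hO)
    obtain ⟨y, hy, hyz⟩ := hx (n + (i + 1))
    rw [PiNat.res_length] at hy hyz
    rw [← hyz i (by omega)]
    exact (hn y (PiNat.res_eq_res.2 fun j hj => PiNat.res_eq_res.1 hy (by omega))).symm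
  · rintro ⟨x, rfl⟩
    exact ⟨x, fun n => ⟨x, by rw [PiNat.res_length], fun _ _ => rfl⟩⟩

theorem isGδ_or_pi11Hard_sigmaIdeal [CompactSpace Y] [MetrizableSpace Y]
    (he : IsEmbedding e) (hτ : τ = hyperTop e)
    (hideal : ∀ (F : Cl X) (A : ℕ → Cl X), (∀ n, A n ∈ I) → F.1 ⊆ ⋃ n, (A n).1 → F ∈ I)
    (hI : MeasureTheory.AnalyticSet Iᶜ) : IsGδ I ∨ Pi11Hard I := by
  have : PseudoMetrizableSpace (Cl X) := hτ ▸ pseudoMetrizableSpace_hyperTop e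
  let := pseudoMetrizableSpacePseudoMetric (Cl X)
  refine or_iff_not_imp_left.2 fun hG => ?_
  rw [MeasureTheory.AnalyticSet] at hI
  obtain hI | ⟨f, hf, hfI⟩ := hI
  · exact absurd (compl_empty_iff.1 hI ▸ IsGδ.univ) hG
  obtain ⟨b, hbI, hb, hlim⟩ := exists_scheme hG hf hfI
  intro A hA
  rw [MeasureTheory.AnalyticSet] at hA
  obtain hA | ⟨g, hg, hgA⟩ := hA
  · refine ⟨fun _ => b [], continuous_const, ?_⟩
    rw [compl_empty_iff.1 hA, preimage_const_of_mem (hbI [])]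
  refine ⟨fun z => treeUnion b (agreeTree g z), continuous_treeUnion he hτ hb
    (fun x => (hlim x).imp fun φ h => h.2) (isClopen_setOf_mem_agreeTree g)
    fun z s t => mem_agreeTree_of_suffix, ?_⟩
  ext z
  rw [mem_preimage, ← not_iff_not, ← mem_compl_iff, ← hgA, ← exists_branch_agreeTree_iff hg]
  constructor
  · rintro ⟨x, hx⟩ hz
    obtain ⟨φ, hφI, hφ⟩ := hlim x
    exact hφI <| hideal φ (fun _ => treeUnion b (agreeTree g z)) (fun _ => hz) <|
      (subset_treeUnion_of_branch he hτ hx hφ).trans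
        (subset_iUnion (fun _ : ℕ => (treeUnion b (agreeTree g z)).1) 0)
  · contrapose
    intro hz
    obtain ⟨σ, hσ⟩ := exists_surjective_nat (List ℕ)
    refine hideal _ (fun n => b (σ n)) (fun n => hbI _) ?_
    refine (treeUnion_subset he hτ hb (fun s t => mem_agreeTree_of_suffix) hz).trans
      (iUnion₂_subset fun s _ => ?_)
    obtain ⟨n, rfl⟩ := hσ s
    exact subset_iUnion (fun n => (b (σ n)).1) n

end Hardness

/-- Let `X` be an analytic space and `I` a `σ`-ideal of `F(X)`.
(a) If `I` is `Σ¹₁` for some admissible topology, then `I` is a `G_δ` subset of `F(X)` for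
every admissible topology. (b) If `I` is `Π¹₁` for some admissible topology, then for
every admissible topology `I` is either a `G_δ` subset of `F(X)` or `Π¹₁`-complete. -/
theorem sigmaIdeal_dichotomy {X : Type*} [TopologicalSpace X] (hX : IsAnalyticSpace X)
    (I : Set (Cl X))
    (hideal : ∀ (F : Cl X) (A : ℕ → Cl X), (∀ n, A n ∈ I) → F.1 ⊆ ⋃ n, (A n).1 → F ∈ I) :
    ((∃ τ : TopologicalSpace (Cl X), IsAdmissible X τ ∧ @MeasureTheory.AnalyticSet _ τ I) →
      ∀ τ : TopologicalSpace (Cl X), IsAdmissible X τ → @IsGδ _ τ I) ∧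
    ((∃ τ : TopologicalSpace (Cl X), IsAdmissible X τ ∧ @MeasureTheory.AnalyticSet _ τ Iᶜ) →
      ∀ τ : TopologicalSpace (Cl X), IsAdmissible X τ →
        @IsGδ _ τ I ∨ (@MeasureTheory.AnalyticSet _ τ Iᶜ ∧ @Pi11Hard _ τ I)) := by
  refine ⟨fun ⟨τ₀, ⟨Y, _, _, _, e, he, hτ₀⟩, hI⟩ τ ⟨Z, _, _, _, e', he', hτ⟩ => ?_,
    fun ⟨τ₀, ⟨Y, _, _, _, e, he, hτ₀⟩, hI⟩ τ ⟨Z, _, _, _, e', he', hτ⟩ => ?_⟩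
  all_goals
    subst hτ₀ hτ
    have hI' := analyticSet_hyperTop_congr he he' hI
    let := hyperTop e'
  · exact isGδ_sigmaIdeal_of_analyticSet he' rfl hideal hI'
  · exact (isGδ_or_pi11Hard_sigmaIdeal he' rfl hideal hI').imp_right fun h => ⟨hI', h⟩
end

section
/- If a separable metrizable space X can be written as a countable union X = ⋃ₙ Fₙ where each Fₙ is a closed subset of X that is either compact or zero-dimensional, then F₀(X) is a G_δ subset of F(X) (for any admissible topology). -/
open Set Filter Topology TopologicalSpace

/-- A set `S` such that every finite open cover of `S` by open sets of the ambient space is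
refined by a partition of `S` into closed sets of the ambient space. -/
def ClosedPartitionable {X : Type*} [TopologicalSpace X] (S : Set X) : Prop :=
  ∀ (k : ℕ) (U : Fin k → Set X), (∀ i, IsOpen (U i)) → S ⊆ ⋃ i, U i →
    ∃ P : Fin k → Set X, (∀ i, IsClosed (P i)) ∧ (∀ i, P i ⊆ U i) ∧
      (∀ i j, i ≠ j → Disjoint (P i) (P j)) ∧ ⋃ i, P i = S

section General

variable {X : Type*} [TopologicalSpace X]

theorem IsClosed.inter_of_disjoint_open_cover {ι : Type*} {S : Set X} (hS : IsClosed S)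
    {Q : ι → Set X} (hQ : ∀ i, IsOpen (Q i)) (hd : ∀ i j, i ≠ j → Disjoint (Q i) (Q j))
    (hc : S ⊆ ⋃ i, Q i) (i : ι) : IsClosed (S ∩ Q i) := by
  have hopen : IsOpen (⋃ j, ⋃ (_ : j ≠ i), Q j) :=
    isOpen_iUnion fun j => isOpen_iUnion fun _ => hQ j
  have heq : S ∩ Q i = S ∩ (⋃ j, ⋃ (_ : j ≠ i), Q j)ᶜ := by
    ext x
    simp only [mem_inter_iff, mem_compl_iff, mem_iUnion, not_exists]
    refine and_congr_right fun hx => ⟨fun hi j hj hxj => ?_, fun hn => ?_⟩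
    · exact Set.disjoint_left.1 (hd j i hj) hxj hi
    · obtain ⟨j, hj⟩ := mem_iUnion.1 (hc hx)
      by_cases hji : j = i
      · exact hji ▸ hj
      · exact absurd hj (hn j hji)
  rw [heq]
  exact hS.inter hopen.isClosed_compl

theorem dimLE_zero_iff_closedPartitionable {S : Set X} (hS : IsClosed S) :
    DimLE S 0 ↔ ClosedPartitionable S := by
  constructor
  · intro h k U hU hSU
    obtain ⟨V, hVo, hVU, hVc, hV⟩ := h k (fun i => Subtype.val ⁻¹' U i)
      (fun i => (hU i).preimage continuous_subtype_val) (by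
        rw [← preimage_iUnion]
        exact eq_univ_of_forall fun x => hSU x.2)
    have hd : ∀ i j, i ≠ j → Disjoint (V i) (V j) := by
      intro i j hij
      refine Set.disjoint_left.2 fun x hi hj => hij ?_
      exact (Set.ncard_le_one (Set.toFinite _)).1 (hV x) i hi j hj
    refine ⟨fun i => Subtype.val '' V i, fun i => ?_, fun i => ?_, fun i j hij => ?_, ?_⟩
    · refine hS.isClosedEmbedding_subtypeVal.isClosedMap _ ?_
      simpa using isClosed_univ.inter_of_disjoint_open_cover hVo hd hVc.ge i
    · exact image_subset_iff.2 (hVU i)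
    · exact (Set.disjoint_image_iff Subtype.val_injective).2 (hd i j hij)
    · rw [← image_iUnion, hVc, image_univ, Subtype.range_coe]
  · intro h k U hU hUc
    choose U' hU'o hU' using fun i => isOpen_induced_iff.1 (hU i)
    obtain ⟨P, hPc, hPU, hPd, hP⟩ := h k U' hU'o (by
      intro x hx
      obtain ⟨i, hi⟩ := mem_iUnion.1 (hUc.ge (mem_univ (⟨x, hx⟩ : S)))
      rw [← hU' i] at hi
      exact mem_iUnion.2 ⟨i, hi⟩)
    refine ⟨fun i => Subtype.val ⁻¹' P i, fun i => ?_, fun i => ?_, ?_, fun x => ?_⟩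
    · have hcl : IsClosed (⋃ j, ⋃ (_ : j ≠ i), P j) :=
        isClosed_iUnion_of_finite fun j => isClosed_iUnion_of_finite fun _ => hPc j
      have heq : (Subtype.val ⁻¹' P i : Set S) =
          Subtype.val ⁻¹' (⋃ j, ⋃ (_ : j ≠ i), P j)ᶜ := by
        ext x
        simp only [mem_preimage, mem_compl_iff, mem_iUnion, not_exists]
        refine ⟨fun hi j hj hxj => Set.disjoint_left.1 (hPd j i hj) hxj hi, fun hn => ?_⟩
        obtain ⟨j, hj⟩ := mem_iUnion.1 (hP.ge x.2)
        by_cases hji : j = i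
        · exact hji ▸ hj
        · exact absurd hj (hn j hji)
      change IsOpen (Subtype.val ⁻¹' P i : Set S)
      rw [heq]
      exact hcl.isOpen_compl.preimage continuous_subtype_val
    · rw [← hU' i]
      exact preimage_mono (hPU i)
    · rw [← preimage_iUnion, hP]
      exact eq_univ_of_forall fun x => x.2
    · refine (Set.ncard_le_one (Set.toFinite _)).2 fun i hi j hj => ?_
      by_contra hij
      exact Set.disjoint_left.1 (hPd i j hij) hi hj

theorem ClosedPartitionable.mono {S T : Set X} (hT : ClosedPartitionable T) (hS : IsClosed S)
    (hST : S ⊆ T) : ClosedPartitionable S := by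
  intro k U hU hSU
  obtain ⟨P, hPc, hPU, hPd, hP⟩ := hT (k + 1) (Fin.cons Sᶜ U)
    (Fin.cases hS.isOpen_compl hU) (by
      intro x _
      by_cases hx : x ∈ S
      · obtain ⟨i, hi⟩ := mem_iUnion.1 (hSU hx)
        exact mem_iUnion.2 ⟨i.succ, hi⟩
      · exact mem_iUnion.2 ⟨0, hx⟩)
  refine ⟨fun i => P i.succ ∩ S, fun i => (hPc _).inter hS,
    fun i => inter_subset_left.trans (hPU i.succ), fun i j hij => ?_, ?_⟩
  · exact (hPd _ _ (fun h => hij (Fin.succ_injective _ h))).mono inter_subset_left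
      inter_subset_left
  · rw [← iUnion_inter]
    refine Subset.antisymm inter_subset_right fun x hx => ⟨?_, hx⟩
    obtain ⟨i, hi⟩ := mem_iUnion.1 (hP.ge (hST hx))
    induction i using Fin.cases with
    | zero => exact absurd hx (hPU 0 hi)
    | succ i => exact mem_iUnion.2 ⟨i, hi⟩

/-- A finite disjoint family of closed sets in a normal space can be swollen to a disjoint family
of open sets. -/
theorem exists_disjoint_open_superset [NormalSpace X] {ι : Type*} [Finite ι] {E U : ι → Set X}
    (hE : ∀ i, IsClosed (E i)) (hU : ∀ i, IsOpen (U i)) (hEU : ∀ i, E i ⊆ U i)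
    (hd : ∀ i j, i ≠ j → Disjoint (E i) (E j)) :
    ∃ O : ι → Set X, (∀ i, IsOpen (O i)) ∧ (∀ i, E i ⊆ O i) ∧ (∀ i, O i ⊆ U i) ∧
      ∀ i j, i ≠ j → Disjoint (O i) (O j) := by
  have hsep : ∀ i, SeparatedNhds (E i) (⋃ j, ⋃ (_ : j ≠ i), E j) := fun i =>
    normal_separation (hE i)
      (isClosed_iUnion_of_finite fun j => isClosed_iUnion_of_finite fun _ => hE j)
      (disjoint_iUnion_right.2 fun j => disjoint_iUnion_right.2 fun hj => hd i j hj.symm)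
  choose G H hG hH hEG hEH hGH using hsep
  refine ⟨fun i => (U i ∩ G i) ∩ ⋂ j, ⋂ (_ : j ≠ i), H j, fun i => ?_, fun i => ?_,
    fun i => inter_subset_left.trans inter_subset_left, fun i j hij => ?_⟩
  · exact ((hU i).inter (hG i)).inter
      (isOpen_iInter_of_finite fun j => isOpen_iInter_of_finite fun _ => hH j)
  · refine subset_inter (subset_inter (hEU i) (hEG i))
      (subset_iInter fun j => subset_iInter fun hj => ?_)
    exact (subset_iUnion₂ (s := fun l (_ : l ≠ j) => E l) i hj.symm).trans (hEH j)
  · refine Set.disjoint_left.2 fun x hi hj => ?_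
    exact Set.disjoint_left.1 (hGH i) hi.1.2 (mem_iInter₂.1 hj.2 i hij)

theorem exists_disjoint_closure_open_superset [NormalSpace X] {ι : Type*} [Finite ι]
    {E U : ι → Set X} (hE : ∀ i, IsClosed (E i)) (hU : ∀ i, IsOpen (U i))
    (hEU : ∀ i, E i ⊆ U i) (hd : ∀ i j, i ≠ j → Disjoint (E i) (E j)) :
    ∃ O : ι → Set X, (∀ i, IsOpen (O i)) ∧ (∀ i, E i ⊆ O i) ∧ (∀ i, closure (O i) ⊆ U i) ∧
      ∀ i j, i ≠ j → Disjoint (closure (O i)) (closure (O j)) := by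
  obtain ⟨W, hWo, hEW, hWU, hWd⟩ := exists_disjoint_open_superset hE hU hEU hd
  choose O hO hEO hOW using fun i => normal_exists_closure_subset (hE i) (hWo i) (hEW i)
  exact ⟨O, hO, hEO, fun i => (hOW i).trans (hWU i),
    fun i j hij => (hWd i j hij).mono (hOW i) (hOW j)⟩

/-- The countable closed sum theorem for dimension zero. -/
theorem ClosedPartitionable.iUnion [NormalSpace X] {S : Set X} (hS : IsClosed S) {T : ℕ → Set X}
    (hT : ∀ n, ClosedPartitionable (T n)) (hST : ⋃ n, T n = S) : ClosedPartitionable S := by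
  intro k U hU hSU
  let 𝓞 := {O : Fin k → Set X // (∀ i, IsOpen (O i)) ∧ (∀ i, closure (O i) ⊆ U i) ∧
    ∀ i j, i ≠ j → Disjoint (closure (O i)) (closure (O j))}
  have step : ∀ (n : ℕ) (O : 𝓞), ∃ O' : 𝓞, (∀ i, O.1 i ⊆ O'.1 i) ∧ T n ⊆ ⋃ i, O'.1 i := by
    rintro n ⟨O, -, hOU, hOd⟩
    obtain ⟨P, hPc, hPW, hPd, hP⟩ := hT n k
      (fun i => U i \ ⋃ j, ⋃ (_ : j ≠ i), closure (O j))
      (fun i => (hU i).sdiff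
        (isClosed_iUnion_of_finite fun j => isClosed_iUnion_of_finite fun _ => isClosed_closure))
      (by
        intro x hx
        by_cases hxO : ∃ j, x ∈ closure (O j)
        · obtain ⟨j, hj⟩ := hxO
          refine mem_iUnion.2 ⟨j, hOU j hj, ?_⟩
          simp only [mem_iUnion, not_exists]
          exact fun l hl hxl => Set.disjoint_left.1 (hOd l j hl) hxl hj
        · obtain ⟨i, hi⟩ := mem_iUnion.1 (hSU (hST ▸ mem_iUnion.2 ⟨n, hx⟩))
          refine mem_iUnion.2 ⟨i, hi, ?_⟩
          simp only [mem_iUnion, not_exists]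
          exact fun l _ hxl => hxO ⟨l, hxl⟩)
    have hPO : ∀ i j, i ≠ j → Disjoint (P i) (closure (O j)) := fun i j hij =>
      Set.disjoint_left.2 fun x hx hxj => (hPW i hx).2 (mem_iUnion₂.2 ⟨j, hij.symm, hxj⟩)
    obtain ⟨O', hO'o, hO', hO'U, hO'd⟩ := exists_disjoint_closure_open_superset
      (E := fun i => closure (O i) ∪ P i) (fun i => isClosed_closure.union (hPc i)) hU
      (fun i => union_subset (hOU i) ((hPW i).trans sdiff_subset))
      (fun i j hij => by
        rw [disjoint_union_left, disjoint_union_right, disjoint_union_right]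
        exact ⟨⟨hOd i j hij, (hPO j i hij.symm).symm⟩, hPO i j hij, hPd i j hij⟩)
    refine ⟨⟨O', hO'o, hO'U, hO'd⟩, fun i => (subset_closure.trans subset_union_left).trans (hO' i),
      ?_⟩
    rw [← hP]
    exact iUnion_mono fun i => subset_union_right.trans (hO' i)
  choose next hnext hcover using step
  let O : ℕ → 𝓞 := fun n => Nat.rec ⟨fun _ => ∅, by simp⟩ next n
  have hmono : ∀ i, Monotone fun n => (O n).1 i := fun i =>
    monotone_nat_of_le_succ fun n => hnext n (O n) i
  have hd : ∀ i j, i ≠ j → Disjoint (⋃ n, (O n).1 i) (⋃ n, (O n).1 j) := by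
    intro i j hij
    refine Set.disjoint_left.2 fun x hi hj => ?_
    obtain ⟨m, hm⟩ := mem_iUnion.1 hi
    obtain ⟨n, hn⟩ := mem_iUnion.1 hj
    exact Set.disjoint_left.1 ((O (max m n)).2.2.2 i j hij)
      (subset_closure (hmono i (le_max_left m n) hm))
      (subset_closure (hmono j (le_max_right m n) hn))
  have hc : S ⊆ ⋃ i, ⋃ n, (O n).1 i := by
    intro x hx
    obtain ⟨n, hn⟩ := mem_iUnion.1 (hST.ge hx)
    obtain ⟨i, hi⟩ := mem_iUnion.1 (hcover n (O n) hn)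
    exact mem_iUnion.2 ⟨i, mem_iUnion.2 ⟨n + 1, hi⟩⟩
  refine ⟨fun i => S ∩ ⋃ n, (O n).1 i, fun i => ?_, fun i => ?_, fun i j hij => ?_, ?_⟩
  · exact hS.inter_of_disjoint_open_cover
      (fun i => isOpen_iUnion fun n => (O n).2.1 i) hd hc i
  · exact inter_subset_right.trans
      (iUnion_subset fun n => subset_closure.trans ((O n).2.2.1 i))
  · exact (hd i j hij).mono inter_subset_right inter_subset_right
  · rw [← inter_iUnion]
    exact inter_eq_left.2 hc

/-- A compact set is zero-dimensional iff its image under an embedding into a metric space is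
covered by finite disjoint families of arbitrarily small open sets. -/
theorem IsCompact.closedPartitionable_iff [T2Space X] {Y : Type*} [MetricSpace Y] {e : X → Y}
    (he : IsEmbedding e) {C : Set X} (hC : IsCompact C) :
    ClosedPartitionable C ↔ ∀ ε > 0, ∃ (k : ℕ) (O : Fin k → Set Y), (∀ i, IsOpen (O i)) ∧
      (∀ i, ∃ y, O i ⊆ Metric.ball y ε) ∧ (∀ i j, i ≠ j → Disjoint (O i) (O j)) ∧
      e '' C ⊆ ⋃ i, O i := by
  have heC : IsCompact (e '' C) := hC.image he.continuous
  constructor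
  · intro h ε hε
    obtain ⟨t, -, ht, hCt⟩ := heC.finite_cover_balls hε
    obtain ⟨k, f, -, rfl⟩ := ht.fin_param
    rw [biUnion_range] at hCt
    obtain ⟨P, hPc, hPU, hPd, hP⟩ := h k (fun i => e ⁻¹' Metric.ball (f i) ε)
      (fun i => Metric.isOpen_ball.preimage he.continuous) (by
        rw [← preimage_iUnion]
        exact image_subset_iff.1 hCt)
    obtain ⟨O, hO, hPO, hOU, hOd⟩ := exists_disjoint_open_superset
      (E := fun i => e '' P i) (U := fun i => Metric.ball (f i) ε)
      (fun i => ((hC.of_isClosed_subset (hPc i) (hP ▸ subset_iUnion P i)).image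
        he.continuous).isClosed)
      (fun i => Metric.isOpen_ball) (fun i => image_subset_iff.2 (hPU i))
      (fun i j hij => (Set.disjoint_image_iff he.injective).2 (hPd i j hij))
    refine ⟨k, O, hO, fun i => ⟨f i, hOU i⟩, hOd, ?_⟩
    rw [← hP, image_iUnion]
    exact iUnion_mono hPO
  · intro h k U hU hCU
    choose U' hU'o hU' using fun i => he.isOpen_iff.1 (hU i)
    obtain ⟨δ, hδ, hball⟩ := lebesgue_number_lemma_of_metric heC hU'o (by
      rw [image_subset_iff, preimage_iUnion]
      simpa only [hU'] using hCU)
    obtain ⟨l, O, hO, hOb, hOd, hCO⟩ := h (δ / 2) (half_pos hδ)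
    have hOU : ∀ j, (e '' C ∩ O j).Nonempty → ∃ i, O j ⊆ U' i := by
      rintro j ⟨z, hzC, hzO⟩
      obtain ⟨y, hy⟩ := hOb j
      obtain ⟨i, hi⟩ := hball z hzC
      refine ⟨i, fun w hw => hi ?_⟩
      have h₁ := Metric.mem_ball.1 (hy hw)
      have h₂ := Metric.mem_ball'.1 (hy hzO)
      exact Metric.mem_ball.2 (by linarith [dist_triangle w y z])
    choose g hg using hOU
    let Q : Fin k → Set X := fun i => e ⁻¹' ⋃ j, ⋃ (hj : _), ⋃ (_ : g j hj = i), O j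
    have hQ : ∀ i x, x ∈ Q i ↔ ∃ j hj, g j hj = i ∧ e x ∈ O j := by
      intro i x
      simp only [Q, mem_preimage, mem_iUnion, exists_prop]
    have hQo : ∀ i, IsOpen (Q i) := fun i => (isOpen_iUnion fun j => isOpen_iUnion fun _ =>
      isOpen_iUnion fun _ => hO j).preimage he.continuous
    have hQd : ∀ i i', i ≠ i' → Disjoint (Q i) (Q i') := by
      refine fun i i' hii => Set.disjoint_left.2 fun x hx hx' => hii ?_
      obtain ⟨j, hj, rfl, hxj⟩ := (hQ _ _).1 hx
      obtain ⟨j', hj', rfl, hxj'⟩ := (hQ _ _).1 hx'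
      obtain rfl : j = j' := by
        by_contra hjj
        exact Set.disjoint_left.1 (hOd j j' hjj) hxj hxj'
      rfl
    have hQc : C ⊆ ⋃ i, Q i := by
      intro x hx
      obtain ⟨j, hj⟩ := mem_iUnion.1 (hCO (mem_image_of_mem e hx))
      exact mem_iUnion.2 ⟨_, (hQ _ _).2 ⟨j, ⟨e x, mem_image_of_mem e hx, hj⟩, rfl, hj⟩⟩
    refine ⟨fun i => C ∩ Q i, hC.isClosed.inter_of_disjoint_open_cover hQo hQd hQc,
      fun i x hx => ?_, fun i j hij => (hQd i j hij).mono inter_subset_right inter_subset_right, ?_⟩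
    · obtain ⟨j, hj, rfl, hxj⟩ := (hQ _ _).1 hx.2
      rw [← hU']
      exact hg j hj hxj
    · rw [← inter_iUnion]
      exact inter_eq_left.2 hQc

theorem Topology.IsEmbedding.closure_image_inter_image {Y : Type*} [TopologicalSpace Y]
    {e : X → Y} (he : IsEmbedding e) {A : Set X} (hA : IsClosed A) (K : Set X) :
    closure (e '' A) ∩ e '' K = e '' (A ∩ K) := by
  have hpre : e ⁻¹' closure (e '' A) = A := by
    rw [← he.closure_eq_preimage_closure_image, hA.closure_eq]
  rw [← image_preimage_inter, hpre]

end General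

/-- If a separable metrizable space `X` is a countable union `X = ⋃ₙ Fₙ` of closed sets
each of which is compact or zero-dimensional, then `F₀(X)` is a `G_δ` subset of `F(X)`
(for any admissible topology). -/
theorem F0_Gdelta_of_countable_union {X : Type*} [TopologicalSpace X]
    [TopologicalSpace.MetrizableSpace X] [TopologicalSpace.SeparableSpace X]
    (F : ℕ → Set X) (hcl : ∀ n, IsClosed (F n)) (hcov : (⋃ n, F n) = Set.univ)
    (h : ∀ n, IsCompact (F n) ∨ DimLE (↥(F n)) 0) :
    ∀ τ : TopologicalSpace (Cl X), IsAdmissible X τ → @IsGδ _ τ (F0 X) := by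
  rintro τ ⟨Y, tY, _, _, e, he, rfl⟩
  let _ : MetricSpace X := metrizableSpaceMetric X
  let _ : MetricSpace Y := metrizableSpaceMetric Y
  let _ : TopologicalSpace (Cl X) := (vietoris Y).induced fun A : Cl X => closure (e '' A.1)
  let G : ℕ × ℕ → Set (Cl X) := fun p => {A | IsCompact (F p.1) →
    ∃ (k : ℕ) (O : Fin k → Set Y), (∀ i, IsOpen (O i)) ∧
      (∀ i, ∃ y, O i ⊆ Metric.ball y (1 / ((p.2 : ℝ) + 1))) ∧
      (∀ i j, i ≠ j → Disjoint (O i) (O j)) ∧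
      closure (e '' A.1) ⊆ (⋃ i, O i) ∪ (e '' F p.1)ᶜ}
  have hG : ∀ p, IsOpen (G p) := by
    intro p
    by_cases hK : IsCompact (F p.1)
    · have hL : IsOpen (e '' F p.1)ᶜ := (hK.image he.continuous).isClosed.isOpen_compl
      simp only [G, hK, true_imp_iff, ofPred_exists, ofPred_and]
      refine isOpen_iUnion fun k => isOpen_iUnion fun O => ?_
      by_cases hO : ∀ i, IsOpen (O i)
      · refine isOpen_const.inter (isOpen_const.inter (isOpen_const.inter ?_))
        exact (@isOpen_induced_iff _ _ (vietoris Y) _ _).2 ⟨{B | B ⊆ (⋃ i, O i) ∪ (e '' F p.1)ᶜ},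
          isOpen_generateFrom_of_mem (Or.inl ⟨_, (isOpen_iUnion hO).union hL, rfl⟩), rfl⟩
      · simp [hO]
    · simp [G, hK]
  have heq : F0 X = ⋂ p, G p := by
    ext A
    have hA : IsClosed A.1 := A.2
    have hAF : A ∈ F0 X ↔ ∀ n, IsCompact (F n) → ClosedPartitionable (A.1 ∩ F n) := by
      refine (dimLE_zero_iff_closedPartitionable hA).trans
        ⟨fun hA' n _ => hA'.mono (hA.inter (hcl n)) inter_subset_left, fun hA' => ?_⟩
      refine ClosedPartitionable.iUnion hA (T := fun n => A.1 ∩ F n) (fun n => ?_)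
        (by rw [← inter_iUnion, hcov, inter_univ])
      rcases h n with hn | hn
      · exact hA' n hn
      · exact ((dimLE_zero_iff_closedPartitionable (hcl n)).1 hn).mono (hA.inter (hcl n))
          inter_subset_right
    have hcover : ∀ n (W : Set Y),
        closure (e '' A.1) ⊆ W ∪ (e '' F n)ᶜ ↔ e '' (A.1 ∩ F n) ⊆ W := by
      intro n W
      rw [← he.closure_image_inter_image hA, subset_union_compl_iff_inter_subset]
    simp only [hAF, mem_iInter, Prod.forall, G, mem_ofPred_eq, hcover]
    refine forall_congr' fun n => ?_
    rw [forall_comm]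
    refine forall_congr' fun hn => ?_
    rw [(hn.inter_left hA).closedPartitionable_iff he]
    refine ⟨fun hε m => hε _ Nat.one_div_pos_of_nat, fun hm ε hε => ?_⟩
    obtain ⟨m, hmε⟩ := exists_nat_one_div_lt hε
    obtain ⟨k, O, hO, hOb, hOd, hc⟩ := hm m
    exact ⟨k, O, hO, fun i => (hOb i).imp fun y hy => hy.trans (Metric.ball_subset_ball hmε.le),
      hOd, hc⟩
  rw [heq]
  exact IsGδ.iInter_of_isOpen hG
end
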